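/- Let M and N be nonzero finitely generated graded modules over A and B, respectively, and regard M ⊗_k N as a graded module over R = A ⊗_k B. Then (i) depth (M ⊗_k N) = depth M + depth N, and (ii) reg (M ⊗_k N) = reg M + reg N. -/

import Mathlib

/-! Core definitions: depth via local cohomology at the maximal homogeneous ideal,
Castelnuovo–Mumford regularity via graded free resolutions, gradings on
subquotients of polynomial rings.  -/

open MvPolynomial

noncomputable section

namespace PaperHTT

variable (k : Type) [Field k]

/-- A polynomial is homogeneous of degree `e : ℤ` (it must vanish in negative degrees). -/
def homogZ {σ : Type} (p : MvPolynomial σ k) (e : ℤ) : Prop :=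
  p = 0 ∨ (0 ≤ e ∧ p.IsHomogeneous e.toNat)

/-- The maximal homogeneous ideal `(x_1, …, x_r)` of a polynomial ring. -/
def maxHomIdeal (σ : Type) : Ideal (MvPolynomial σ k) :=
  Ideal.span (Set.range MvPolynomial.X)

/-- The depth of a module over a polynomial ring with respect to the maximal homogeneous
ideal: the least `i` such that the `i`-th local cohomology is non-vanishing. -/
def depthM {σ : Type} (M : ModuleCat (MvPolynomial σ k)) : ℕ :=
  sInf {i : ℕ | Nontrivial ((localCohomology (maxHomIdeal k σ) i).obj M)}

/-- The subquotient `p/q` of a polynomial ring, for ideals `q ≤ p`. -/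
abbrev subQuot {σ : Type} (p q : Ideal (MvPolynomial σ k)) : Type :=
  ↥p ⧸ (Submodule.comap p.subtype q)

/-- The degree-`t` graded piece of `p/q`: the image of the homogeneous elements of
degree `t` of `p`. -/
def subQuotGr {σ : Type} (p q : Ideal (MvPolynomial σ k)) (t : ℤ) :
    AddSubgroup (subQuot k p q) :=
  AddSubgroup.closure
    {x | ∃ f : p, homogZ k (f : MvPolynomial σ k) t ∧ x = Submodule.Quotient.mk f}

/-- The degree-`t` graded piece of the quotient ring `P/Q`. -/
def quotGr {σ : Type} (Q : Ideal (MvPolynomial σ k)) (t : ℤ) :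
    AddSubgroup (MvPolynomial σ k ⧸ Q) :=
  AddSubgroup.closure {x | ∃ f, homogZ k f t ∧ x = Ideal.Quotient.mk Q f}

/-- The degree-`t` graded piece of an ideal `p`, viewed as a module. -/
def idealGr {σ : Type} (p : Ideal (MvPolynomial σ k)) (t : ℤ) : AddSubgroup ↥p :=
  AddSubgroup.closure {x : p | homogZ k (x : MvPolynomial σ k) t}

/-- A finite graded free resolution of a module `M` over a polynomial ring,
with respect to a grading `gr` of `M`: `F_i` is free of rank `rk i`, with basis elements
of (twisted) degrees `tw i l`, the differentials and augmentation are graded of degree `0`,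
and the complex `⋯ → F_1 → F_0 → M → 0` is exact. -/
structure GradedFreeRes (σ : Type) (M : Type) [AddCommGroup M]
    [Module (MvPolynomial σ k) M] (gr : ℤ → AddSubgroup M) where
  rk : ℕ → ℕ
  tw : (i : ℕ) → Fin (rk i) → ℤ
  bdd : ∃ N, ∀ i, N ≤ i → rk i = 0
  aug : (Fin (rk 0) → MvPolynomial σ k) →ₗ[MvPolynomial σ k] M
  d : (i : ℕ) →
    ((Fin (rk (i + 1)) → MvPolynomial σ k) →ₗ[MvPolynomial σ k]
      (Fin (rk i) → MvPolynomial σ k))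
  aug_surj : Function.Surjective aug
  exact_zero : LinearMap.range (d 0) = LinearMap.ker aug
  exact_succ : ∀ i, LinearMap.range (d (i + 1)) = LinearMap.ker (d i)
  aug_homog : ∀ l, aug (Pi.single l 1) ∈ gr (tw 0 l)
  d_homog : ∀ i l l', homogZ k (d i (Pi.single l 1) l') (tw (i + 1) l - tw i l')

/-- The Castelnuovo–Mumford regularity of a (finitely generated) graded module over a
polynomial ring: the least `r` such that `M` admits a graded free resolution with all
twists in homological degree `i` at most `r + i`.  (By minimal free resolutions, this
agrees with `max {aⁱ(M) + i}`.) -/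
def regM (σ : Type) (M : Type) [AddCommGroup M] [Module (MvPolynomial σ k) M]
    (gr : ℤ → AddSubgroup M) : ℤ :=
  sInf {r : ℤ | ∃ F : GradedFreeRes k σ M gr, ∀ i (l : Fin (F.rk i)), F.tw i l - (i : ℤ) ≤ r}

/-- Depth of the quotient ring `P/Q` as a module over `P`. -/
def depthQuot {σ : Type} (Q : Ideal (MvPolynomial σ k)) : ℕ :=
  depthM k (ModuleCat.of (MvPolynomial σ k) (MvPolynomial σ k ⧸ Q))

/-- Depth of the subquotient `p/q` as a module over the polynomial ring. -/
def depthSubQuot {σ : Type} (p q : Ideal (MvPolynomial σ k)) : ℕ :=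
  depthM k (ModuleCat.of (MvPolynomial σ k) (subQuot k p q))

/-- Depth of an ideal `p` as a module over the polynomial ring. -/
def depthIdeal {σ : Type} (p : Ideal (MvPolynomial σ k)) : ℕ :=
  depthM k (ModuleCat.of (MvPolynomial σ k) ↥p)

/-- Regularity of the quotient ring `P/Q`. -/
def regQuot {σ : Type} (Q : Ideal (MvPolynomial σ k)) : ℤ :=
  regM k σ (MvPolynomial σ k ⧸ Q) (quotGr k Q)

/-- Regularity of the subquotient `p/q`. -/
def regSubQuot {σ : Type} (p q : Ideal (MvPolynomial σ k)) : ℤ :=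
  regM k σ (subQuot k p q) (subQuotGr k p q)

/-- Regularity of an ideal `p`, viewed as a graded module. -/
def regIdeal {σ : Type} (p : Ideal (MvPolynomial σ k)) : ℤ :=
  regM k σ (↥p) (idealGr k p)

/-- A homogeneous ideal: one containing all homogeneous components of its elements. -/
def IsHomogeneousIdeal {σ : Type} (I : Ideal (MvPolynomial σ k)) : Prop :=
  ∀ f ∈ I, ∀ m : ℕ, MvPolynomial.homogeneousComponent m f ∈ I

/-- A monomial ideal. -/
def IsMonomialIdeal {σ : Type} (I : Ideal (MvPolynomial σ k)) : Prop :=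
  ∃ S : Set (σ →₀ ℕ), I = Ideal.span ((fun a => MvPolynomial.monomial a (1 : k)) '' S)

/-- A squarefree monomial ideal. -/
def IsSquarefreeMonomialIdeal {σ : Type} (I : Ideal (MvPolynomial σ k)) : Prop :=
  ∃ S : Set (σ →₀ ℕ), (∀ a ∈ S, ∀ x, a x ≤ 1) ∧
    I = Ideal.span ((fun a => MvPolynomial.monomial a (1 : k)) '' S)


/-- The quotient ring `P/Q` is Cohen–Macaulay: its depth equals its Krull dimension. -/
def IsCMQuot {σ : Type} (Q : Ideal (MvPolynomial σ k)) : Prop :=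
  (depthQuot k Q : WithBot (WithTop ℕ)) = ringKrullDim (MvPolynomial σ k ⧸ Q)

/-- An isomorphism of graded modules: a linear isomorphism matching up the gradings. -/
def GradedIso {P : Type} [CommRing P] {M N : Type} [AddCommGroup M] [Module P M]
    [AddCommGroup N] [Module P N] (grM : ℤ → AddSubgroup M) (grN : ℤ → AddSubgroup N) :
    Prop :=
  ∃ e : M ≃ₗ[P] N, ∀ t, (grM t).map e.toLinearMap.toAddMonoidHom = grN t

/-- `gr` is an (internal, ℤ-) grading of the module `M` over a polynomial ring,
compatible with the standard grading of the polynomial ring. -/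
def IsGrading (σ : Type) {M : Type} [AddCommGroup M] [Module (MvPolynomial σ k) M]
    (gr : ℤ → AddSubgroup M) : Prop :=
  DirectSum.IsInternal (fun t : ℤ => gr t) ∧
    ∀ (p : MvPolynomial σ k) (d : ℕ) (t : ℤ) (m : M), p.IsHomogeneous d → m ∈ gr t →
      p • m ∈ gr (t + d)

/-- The polynomial ring `A = k[x_1,…,x_r]`. -/
abbrev PA (r : ℕ) : Type := MvPolynomial (Fin r) k

/-- The polynomial ring `B = k[y_1,…,y_s]`. -/
abbrev PB (s : ℕ) : Type := MvPolynomial (Fin s) k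

/-- The polynomial ring `R = k[x_1,…,x_r,y_1,…,y_s]`. -/
abbrev PR (r s : ℕ) : Type := MvPolynomial (Fin r ⊕ Fin s) k

/-- The extension of an ideal `I ⊆ A` to `R`. -/
def extA {r s : ℕ} (I : Ideal (PA k r)) : Ideal (PR k r s) :=
  I.map (MvPolynomial.rename (Sum.inl : Fin r → Fin r ⊕ Fin s))

/-- The extension of an ideal `J ⊆ B` to `R`. -/
def extB {r s : ℕ} (J : Ideal (PB k s)) : Ideal (PR k r s) :=
  J.map (MvPolynomial.rename (Sum.inr : Fin s → Fin r ⊕ Fin s))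

/-- The ideal `I + J ⊆ R`. -/
def sumIJ {r s : ℕ} (I : Ideal (PA k r)) (J : Ideal (PB k s)) : Ideal (PR k r s) :=
  extA k I + extB k J

end PaperHTT

end

noncomputable section

namespace PaperHTT

open TensorProduct

variable (k : Type) [Field k]

section Tensor

variable {r s : ℕ}
variable (M : Type) [AddCommGroup M] [Module (PA k r) M] [Module k M]
  [IsScalarTower k (PA k r) M]
variable (N : Type) [AddCommGroup N] [Module (PB k s) N] [Module k N]
  [IsScalarTower k (PB k s) N]

/-- The action of `B` on `M ⊗[k] N` through the right factor. -/
def rightModuleTens : Module (PB k s) (M ⊗[k] N) where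
  smul b x := (TensorProduct.comm k M N).symm (b • (TensorProduct.comm k M N x))
  one_smul x := by
    show (TensorProduct.comm k M N).symm (1 • (TensorProduct.comm k M N x)) = x
    rw [one_smul, LinearEquiv.symm_apply_apply]
  mul_smul a b x := by
    show (TensorProduct.comm k M N).symm ((a * b) • (TensorProduct.comm k M N x)) =
      (TensorProduct.comm k M N).symm (a • (TensorProduct.comm k M N
        ((TensorProduct.comm k M N).symm (b • (TensorProduct.comm k M N x)))))
    rw [LinearEquiv.apply_symm_apply, mul_smul]
  smul_zero b := by
    show (TensorProduct.comm k M N).symm (b • (TensorProduct.comm k M N 0)) = 0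
    simp
  smul_add b x y := by
    show (TensorProduct.comm k M N).symm (b • (TensorProduct.comm k M N (x + y))) =
      (TensorProduct.comm k M N).symm (b • (TensorProduct.comm k M N x)) +
      (TensorProduct.comm k M N).symm (b • (TensorProduct.comm k M N y))
    rw [map_add, smul_add, map_add]
  add_smul a b x := by
    show (TensorProduct.comm k M N).symm ((a + b) • (TensorProduct.comm k M N x)) =
      (TensorProduct.comm k M N).symm (a • (TensorProduct.comm k M N x)) +
      (TensorProduct.comm k M N).symm (b • (TensorProduct.comm k M N x))
    rw [add_smul, map_add]
  zero_smul x := by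
    show (TensorProduct.comm k M N).symm ((0 : PB k s) • (TensorProduct.comm k M N x)) = 0
    rw [zero_smul, map_zero]

/-- The algebra map `R → A ⊗[k] B`. -/
def toTensAlg (r s : ℕ) : PR k r s →ₐ[k] (PA k r) ⊗[k] (PB k s) :=
  MvPolynomial.aeval (Sum.elim
    (fun i => (MvPolynomial.X i : PA k r) ⊗ₜ[k] (1 : PB k s))
    (fun j => (1 : PA k r) ⊗ₜ[k] (MvPolynomial.X j : PB k s)))

/-- The `R = A ⊗_k B`-module structure on `M ⊗_k N`, for `M` an `A`-module and `N` a
`B`-module. -/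
def tensModuleR : Module (PR k r s) (M ⊗[k] N) :=
  letI instB : Module (PB k s) (M ⊗[k] N) := rightModuleTens k M N
  letI : SMulCommClass (PA k r) (PB k s) (M ⊗[k] N) := by
    constructor
    intro a b x
    show a • ((TensorProduct.comm k M N).symm (b • (TensorProduct.comm k M N x))) =
      (TensorProduct.comm k M N).symm (b • (TensorProduct.comm k M N (a • x)))
    induction x using TensorProduct.induction_on with
    | zero => simp
    | tmul m n =>
        simp only [TensorProduct.smul_tmul', TensorProduct.comm_tmul,
          TensorProduct.comm_symm_tmul]
    | add x y hx hy =>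
        rw [map_add, smul_add, map_add, smul_add, smul_add, map_add, smul_add, map_add, hx, hy]
  letI : IsScalarTower k (PB k s) (M ⊗[k] N) := by
    constructor
    intro c b x
    show (TensorProduct.comm k M N).symm ((c • b) • (TensorProduct.comm k M N x)) =
      c • ((TensorProduct.comm k M N).symm (b • (TensorProduct.comm k M N x)))
    rw [smul_assoc, map_smul]
  letI : Module ((PA k r) ⊗[k] (PB k s)) (M ⊗[k] N) := TensorProduct.Algebra.module
  Module.compHom (M ⊗[k] N) (toTensAlg k r s).toRingHom

/-- The degree-`t` graded piece of `M ⊗_k N`, for graded modules `M` and `N`. -/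
def tensGr (grM : ℤ → AddSubgroup M) (grN : ℤ → AddSubgroup N) (t : ℤ) :
    AddSubgroup (M ⊗[k] N) :=
  AddSubgroup.closure
    {x | ∃ (a b : ℤ) (m : M) (n : N), a + b = t ∧ m ∈ grM a ∧ n ∈ grN b ∧ x = m ⊗ₜ[k] n}

end Tensor

/-- The degree-`t` graded piece of a direct sum of graded modules. -/
def dsGr {ι : Type} [DecidableEq ι] (T : ι → Type) [∀ i, AddCommGroup (T i)]
    (gr : ∀ i, ℤ → AddSubgroup (T i)) (t : ℤ) : AddSubgroup (DirectSum ι T) :=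
  AddSubgroup.closure {x | ∃ (i : ι) (y : T i), y ∈ gr i t ∧ x = DirectSum.of T i y}

end PaperHTT

end

namespace PaperHTT

section Homogeneous

variable {k : Type} [Field k] {σ : Type}

/-- The homogeneous component of degree `e : ℤ`, zero in negative degrees. -/
noncomputable def homogCompZ (e : ℤ) : MvPolynomial σ k →ₗ[k] MvPolynomial σ k :=
  if 0 ≤ e then homogeneousComponent e.toNat else 0

theorem homogZ_zero (e : ℤ) : homogZ k (0 : MvPolynomial σ k) e := Or.inl rfl

theorem homogZ_of_isHomogeneous {p : MvPolynomial σ k} {n : ℕ} (hp : p.IsHomogeneous n) :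
    homogZ k p n := Or.inr ⟨Int.natCast_nonneg n, by simpa using hp⟩

theorem homogZ_natCast {p : MvPolynomial σ k} {n : ℕ} :
    homogZ k p n ↔ p.IsHomogeneous n := by
  refine ⟨?_, homogZ_of_isHomogeneous⟩
  rintro (rfl | ⟨_, h⟩)
  · exact isHomogeneous_zero _ _ _
  · simpa using h

theorem homogZ_neg_degree {p : MvPolynomial σ k} {e : ℤ} (he : e < 0) :
    homogZ k p e ↔ p = 0 :=
  ⟨fun h => h.resolve_right fun h => by omega, Or.inl⟩

theorem homogZ.add {p q : MvPolynomial σ k} {e : ℤ} (hp : homogZ k p e) (hq : homogZ k q e) :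
    homogZ k (p + q) e := by
  rcases lt_or_ge e 0 with he | he
  · rw [homogZ_neg_degree he] at *
    simp [hp, hq]
  · lift e to ℕ using he
    rw [homogZ_natCast] at *
    exact hp.add hq

theorem homogZ.neg {p : MvPolynomial σ k} {e : ℤ} (hp : homogZ k p e) : homogZ k (-p) e := by
  rcases hp with rfl | ⟨he, h⟩
  · rw [neg_zero]
    exact homogZ_zero e
  · exact Or.inr ⟨he, h.neg⟩

theorem homogZ.isHomogeneous_mul {p q : MvPolynomial σ k} {d : ℕ} {e : ℤ}
    (hp : p.IsHomogeneous d) (hq : homogZ k q e) : homogZ k (p * q) (e + d) := by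
  rcases hq with rfl | ⟨he, h⟩
  · rw [mul_zero]
    exact homogZ_zero _
  · lift e to ℕ using he
    rw [← Nat.cast_add, homogZ_natCast, add_comm]
    exact hp.mul (by simpa using h)

theorem homogZ_homogCompZ (e : ℤ) (p : MvPolynomial σ k) : homogZ k (homogCompZ e p) e := by
  rw [homogCompZ]
  split_ifs with he
  · exact Or.inr ⟨he, homogeneousComponent_isHomogeneous _ _⟩
  · exact homogZ_zero e

theorem homogCompZ_of_homogZ {p : MvPolynomial σ k} {e : ℤ} (hp : homogZ k p e) :
    homogCompZ e p = p := by
  rcases hp with rfl | ⟨he, h⟩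
  · simp
  · rw [homogCompZ, if_pos he, homogeneousComponent_eq_self h]

theorem homogCompZ_of_homogZ_ne {p : MvPolynomial σ k} {e e' : ℤ} (hp : homogZ k p e)
    (hne : e ≠ e') : homogCompZ e' p = 0 := by
  rcases hp with rfl | ⟨he, h⟩
  · simp
  · rw [homogCompZ]
    split_ifs with he'
    · rw [homogeneousComponent_of_mem h, if_neg (by omega)]
    · rfl

theorem homogZ.eq_zero_of_constantCoeff_ne_zero {p : MvPolynomial σ k} {e : ℤ}
    (hp : homogZ k p e) (h : constantCoeff p ≠ 0) : e = 0 := by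
  rcases hp with rfl | ⟨he, hp⟩
  · simp at h
  · have := hp (d := 0) h
    simp at this
    omega

theorem homogZ_zero_degree {p : MvPolynomial σ k} (hp : homogZ k p 0) :
    p = C (constantCoeff p) := by
  rcases hp with rfl | ⟨_, hp⟩
  · simp
  · exact totalDegree_eq_zero_iff_eq_C.1
      ((totalDegree_zero_iff_isHomogeneous σ).2 hp)

theorem constantCoeff_homogCompZ_zero (p : MvPolynomial σ k) :
    constantCoeff (homogCompZ 0 p) = constantCoeff p := by
  simp [homogCompZ, homogeneousComponent_zero, constantCoeff_eq]

theorem sum_homogCompZ (p : MvPolynomial σ k) :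
    ∑ i ∈ Finset.range (p.totalDegree + 1), homogCompZ (i : ℤ) p = p := by
  conv_rhs => rw [← sum_homogeneousComponent p]
  exact Finset.sum_congr rfl fun i _ => by simp [homogCompZ]

end Homogeneous

section GradedDecomposition

variable {k : Type} [Field k] {σ : Type}

/-- A decomposition of a module over a polynomial ring into graded pieces, given by its
projections. -/
structure GradedDecomp (k : Type) [Field k] (σ : Type) {M : Type} [AddCommGroup M]
    [Module (MvPolynomial σ k) M]
    (gr : ℤ → AddSubgroup M) where
  proj : ℤ → M →+ M
  proj_same : ∀ {t m}, m ∈ gr t → proj t m = m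
  proj_ne : ∀ {t t' m}, m ∈ gr t → t ≠ t' → proj t' m = 0
  smul_mem : ∀ {p : MvPolynomial σ k} {d : ℕ} {t m}, p.IsHomogeneous d → m ∈ gr t →
    p • m ∈ gr (t + d)
  span : ∀ m, m ∈ AddSubgroup.closure {x | ∃ t, x ∈ gr t}

variable {M : Type} [AddCommGroup M] [Module (MvPolynomial σ k) M] {gr : ℤ → AddSubgroup M}

theorem GradedDecomp.proj_mem (G : GradedDecomp k σ gr) (t : ℤ) (m : M) :
    G.proj t m ∈ gr t := by
  induction G.span m using AddSubgroup.closure_induction with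
  | mem x hx =>
    obtain ⟨t', ht'⟩ := hx
    rcases eq_or_ne t' t with rfl | h
    · rwa [G.proj_same ht']
    · rw [G.proj_ne ht' h]
      exact zero_mem _
  | zero => rw [map_zero]; exact zero_mem _
  | add x y _ _ hx hy => rw [map_add]; exact add_mem hx hy
  | neg x _ hx => rw [map_neg]; exact neg_mem hx

theorem GradedDecomp.homogZ_smul_mem (G : GradedDecomp k σ gr) {p : MvPolynomial σ k}
    {e t : ℤ} {m : M} (hp : homogZ k p e) (hm : m ∈ gr t) : p • m ∈ gr (t + e) := by
  rcases hp with rfl | ⟨he, hp⟩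
  · rw [zero_smul]; exact zero_mem _
  · lift e to ℕ using he
    exact G.smul_mem (by simpa using hp) hm

theorem GradedDecomp.proj_smul (G : GradedDecomp k σ gr) {t t' : ℤ} {m : M}
    (hm : m ∈ gr t) (p : MvPolynomial σ k) :
    G.proj t' (p • m) = homogCompZ (t' - t) p • m := by
  have key : ∀ q : MvPolynomial σ k, ∀ e, homogZ k q e →
      G.proj t' (q • m) = homogCompZ (t' - t) q • m := by
    intro q e hp
    rcases eq_or_ne e (t' - t) with rfl | hne
    · rw [homogCompZ_of_homogZ hp, G.proj_same]
      simpa using G.homogZ_smul_mem hp hm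
    · rw [homogCompZ_of_homogZ_ne hp hne, zero_smul]
      exact G.proj_ne (G.homogZ_smul_mem hp hm) (by omega)
  rw [← sum_homogCompZ p, Finset.sum_smul, map_sum, map_sum, Finset.sum_smul]
  exact Finset.sum_congr rfl fun i _ => key _ i (homogZ_homogCompZ _ _)

/-- An internal grading yields a decomposition. -/
noncomputable def IsGrading.gradedDecomp (h : IsGrading k σ gr) : GradedDecomp k σ gr :=
  letI := h.1.chooseDecomposition
  { proj := fun t =>
      { toFun := fun m => (DirectSum.decompose gr m t : M)
        map_zero' := by simp
        map_add' := by simp }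
    proj_same := fun hm => DirectSum.decompose_of_mem_same gr hm
    proj_ne := fun hm hne => DirectSum.decompose_of_mem_ne gr hm hne
    smul_mem := fun hp hm => h.2 _ _ _ _ hp hm
    span := fun m => by
      classical
      rw [← DirectSum.sum_support_decompose gr m]
      exact sum_mem fun i _ => AddSubgroup.subset_closure ⟨i, SetLike.coe_mem _⟩ }

end GradedDecomposition

section FreeGrading

variable {k : Type} [Field k] {σ L : Type}

/-- The grading of a free module whose basis elements have degrees `tw`. -/
noncomputable def freeGr (tw : L → ℤ) (t : ℤ) : AddSubgroup (L → MvPolynomial σ k) where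
  carrier := {z | ∀ l, homogZ k (z l) (t - tw l)}
  zero_mem' := fun _ => homogZ_zero _
  add_mem' := fun ha hb l => (ha l).add (hb l)
  neg_mem' := fun ha l => (ha l).neg

/-- The homogeneous component of degree `t` in a twisted free module. -/
noncomputable def freeComp (tw : L → ℤ) (t : ℤ) :
    (L → MvPolynomial σ k) →+ (L → MvPolynomial σ k) where
  toFun z l := homogCompZ (t - tw l) (z l)
  map_zero' := by ext; simp
  map_add' x y := by ext; simp

@[simp]
theorem freeComp_apply (tw : L → ℤ) (t : ℤ) (z : L → MvPolynomial σ k) (l : L) :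
    freeComp tw t z l = homogCompZ (t - tw l) (z l) := rfl

theorem single_mem_freeGr [DecidableEq L] (tw : L → ℤ) (l : L) {p : MvPolynomial σ k} {e : ℤ}
    (hp : homogZ k p e) : Pi.single l p ∈ freeGr tw (tw l + e) := by
  intro l'
  rcases eq_or_ne l' l with rfl | h
  · simpa using hp
  · rw [Pi.single_eq_of_ne h]
    exact homogZ_zero _

/-- The decomposition of a twisted free module. -/
noncomputable def freeDecomp [Finite L] (tw : L → ℤ) :
    GradedDecomp k σ (freeGr (k := k) (σ := σ) tw) where
  proj := freeComp tw
  proj_same hm := funext fun l => homogCompZ_of_homogZ (hm l)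
  proj_ne hm hne := funext fun l => homogCompZ_of_homogZ_ne (hm l) (by omega)
  smul_mem {p d t m} hp hm l := by
    have := homogZ.isHomogeneous_mul hp (hm l)
    rwa [show t - tw l + d = t + d - tw l by ring] at this
  span m := by
    classical
    have := Fintype.ofFinite L
    rw [← Finset.univ_sum_single m]
    refine sum_mem fun l _ => ?_
    rw [← sum_homogCompZ (m l), show Pi.single l (∑ i ∈ Finset.range ((m l).totalDegree + 1),
      homogCompZ (i : ℤ) (m l)) = ∑ i ∈ Finset.range ((m l).totalDegree + 1),
      (Pi.single l (homogCompZ (i : ℤ) (m l)) : L → MvPolynomial σ k) from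
        map_sum (AddMonoidHom.single (fun _ : L => MvPolynomial σ k) l) _ _]
    exact sum_mem fun i _ => AddSubgroup.subset_closure
      ⟨_, single_mem_freeGr tw l (homogZ_homogCompZ _ _)⟩

theorem linearMap_apply_eq_sum [Fintype L] [DecidableEq L] {R M : Type} [CommRing R]
    [AddCommGroup M] [Module R M] (f : (L → R) →ₗ[R] M) (z : L → R) :
    f z = ∑ l, z l • f (Pi.single l 1) := by
  conv_lhs => rw [pi_eq_sum_univ' z]
  simp only [map_sum, map_smul]

variable {M : Type} [AddCommGroup M] [Module (MvPolynomial σ k) M] {gr : ℤ → AddSubgroup M}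

theorem GradedDecomp.proj_linearMap [Finite L] [DecidableEq L] (G : GradedDecomp k σ gr)
    {tw : L → ℤ}
    {f : (L → MvPolynomial σ k) →ₗ[MvPolynomial σ k] M}
    (hf : ∀ l, f (Pi.single l 1) ∈ gr (tw l)) (t : ℤ) (z : L → MvPolynomial σ k) :
    G.proj t (f z) = f (freeComp tw t z) := by
  have := Fintype.ofFinite L
  rw [linearMap_apply_eq_sum f z, linearMap_apply_eq_sum f (freeComp tw t z), map_sum]
  exact Finset.sum_congr rfl fun l _ => G.proj_smul (hf l) _

/-- The grading induced on a submodule. -/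
noncomputable def submoduleGr {M : Type} [AddCommGroup M] [Module (MvPolynomial σ k) M]
    (gr : ℤ → AddSubgroup M) (K : Submodule (MvPolynomial σ k) M) (t : ℤ) : AddSubgroup K :=
  (gr t).comap K.subtype.toAddMonoidHom

/-- The decomposition of the kernel of a graded map from a twisted free module. -/
noncomputable def GradedDecomp.ker [Finite L] [DecidableEq L] (G : GradedDecomp k σ gr)
    {tw : L → ℤ}
    {f : (L → MvPolynomial σ k) →ₗ[MvPolynomial σ k] M}
    (hf : ∀ l, f (Pi.single l 1) ∈ gr (tw l)) :
    GradedDecomp k σ (submoduleGr (freeGr tw) (LinearMap.ker f)) where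
  proj t :=
    { toFun := fun z => ⟨freeComp tw t z, by
        rw [LinearMap.mem_ker, ← G.proj_linearMap hf, LinearMap.mem_ker.1 z.2, map_zero]⟩
      map_zero' := by ext; simp
      map_add' := fun x y => by ext; simp }
  proj_same hm := Subtype.ext ((freeDecomp tw).proj_same hm)
  proj_ne hm hne := Subtype.ext ((freeDecomp tw).proj_ne hm hne)
  smul_mem hp hm := (freeDecomp tw).smul_mem hp hm
  span m := by
    have hdeg : ∃ s : Finset ℤ, (m : L → MvPolynomial σ k) = ∑ t ∈ s, freeComp tw t m := by
      have : ∀ x : L → MvPolynomial σ k, ∃ s : Finset ℤ, ∀ s', s ⊆ s' →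
          x = ∑ t ∈ s', freeComp tw t x := by
        intro x
        induction (freeDecomp tw).span x using AddSubgroup.closure_induction with
        | mem x hx =>
          obtain ⟨t, ht⟩ := hx
          refine ⟨{t}, fun s' hs' => ?_⟩
          rw [Finset.sum_eq_single t]
          · exact ((freeDecomp tw).proj_same ht).symm
          · exact fun t' _ ht' => (freeDecomp tw).proj_ne ht ht'.symm
          · exact fun h => absurd (hs' (by simp)) h
        | zero => exact ⟨∅, fun t _ => by simp⟩
        | add x y _ _ hx hy =>
          classical
          obtain ⟨s, hs⟩ := hx
          obtain ⟨s', hs'⟩ := hy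
          refine ⟨s ∪ s', fun u hu => ?_⟩
          simp only [map_add, Finset.sum_add_distrib]
          rw [← hs u (Finset.union_subset_left hu), ← hs' u (Finset.union_subset_right hu)]
        | neg x _ hx =>
          obtain ⟨s, hs⟩ := hx
          refine ⟨s, fun u hu => ?_⟩
          simp only [map_neg, Finset.sum_neg_distrib]
          rw [← hs u hu]
      obtain ⟨s, hs⟩ := this m
      exact ⟨s, hs s subset_rfl⟩
    obtain ⟨s, hs⟩ := hdeg
    have hm : m = ∑ t ∈ s, (⟨freeComp tw t m, by
        rw [LinearMap.mem_ker, ← G.proj_linearMap hf, LinearMap.mem_ker.1 m.2, map_zero]⟩ :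
          LinearMap.ker f) := by
      ext1
      rw [AddSubmonoidClass.coe_finsetSum]
      exact hs
    rw [hm]
    exact sum_mem fun t _ => AddSubgroup.subset_closure ⟨t, AddSubgroup.mem_comap.2
      ((freeDecomp tw).proj_mem t (m : L → MvPolynomial σ k))⟩

end FreeGrading

section VariableIdeals

variable {k : Type} [Field k] {σ : Type}

theorem X_mul_mem_span_X_image {S : Set σ} {a : σ} (ha : a ∉ S) {p : MvPolynomial σ k}
    (hp : X a * p ∈ Ideal.span (X '' S : Set (MvPolynomial σ k))) :
    p ∈ Ideal.span (X '' S : Set (MvPolynomial σ k)) := by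
  classical
  rw [mem_ideal_span_X_image] at *
  intro m hm
  obtain ⟨i, hi, h⟩ := hp (Finsupp.single a 1 + m) (by
    rw [mem_support_iff, coeff_X_mul]
    exact mem_support_iff.1 hm)
  refine ⟨i, hi, ?_⟩
  have : a ≠ i := fun h => ha (h ▸ hi)
  simpa [Finsupp.single_apply, this] using h

theorem mem_maxHomIdeal_iff {p : MvPolynomial σ k} :
    p ∈ maxHomIdeal k σ ↔ constantCoeff p = 0 := by
  rw [maxHomIdeal, ← Set.image_univ, mem_ideal_span_X_image]
  constructor
  · intro h
    by_contra h0
    obtain ⟨i, -, hi⟩ := h 0 (mem_support_iff.2 h0)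
    simp at hi
  · intro h m hm
    by_contra! hne
    have : m = 0 := Finsupp.ext fun i => hne i trivial
    rw [this, mem_support_iff] at hm
    exact hm h

theorem linearMap_apply_mem {L L' R : Type} [Finite L] [CommRing R] (I : Ideal R)
    (f : (L → R) →ₗ[R] (L' → R)) {z : L → R} (hz : ∀ l, z l ∈ I) (l' : L') : f z l' ∈ I := by
  classical
  have := Fintype.ofFinite L
  rw [linearMap_apply_eq_sum f z, Finset.sum_apply]
  exact sum_mem fun l _ => I.mul_mem_right _ (hz l)

theorem linearMap_apply_mem_of_entries {L L' R : Type} [Finite L] [DecidableEq L] [CommRing R]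
    (I : Ideal R) (f : (L → R) →ₗ[R] (L' → R))
    (hf : ∀ l l', f (Pi.single l 1) l' ∈ I) (z : L → R) (l' : L') : f z l' ∈ I := by
  have := Fintype.ofFinite L
  rw [linearMap_apply_eq_sum f z, Finset.sum_apply]
  exact sum_mem fun l _ => I.mul_mem_left _ (hf l l')

end VariableIdeals

section MinimalCover

variable {k : Type} [Field k] {σ : Type}
variable {M : Type} [AddCommGroup M] [Module (MvPolynomial σ k) M] {gr : ℤ → AddSubgroup M}

theorem GradedDecomp.exists_homogeneous_generators (G : GradedDecomp k σ gr)
    [Module.Finite (MvPolynomial σ k) M] :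
    ∃ (n : ℕ) (tw : Fin n → ℤ) (v : Fin n → M), (∀ l, v l ∈ gr (tw l)) ∧
      Submodule.span (MvPolynomial σ k) (Set.range v) = ⊤ := by
  have htop : Submodule.span (MvPolynomial σ k) {x | ∃ t, x ∈ gr t} = ⊤ := by
    rw [eq_top_iff]
    intro m _
    have : AddSubgroup.closure {x | ∃ t, x ∈ gr t} ≤
        (Submodule.span (MvPolynomial σ k) {x | ∃ t, x ∈ gr t}).toAddSubgroup := by
      rw [AddSubgroup.closure_le]
      exact Submodule.subset_span
    exact this (G.span m)
  have hfg : (Submodule.span (MvPolynomial σ k) {x | ∃ t, x ∈ gr t}).FG := by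
    rw [htop]
    exact Module.Finite.fg_top
  obtain ⟨S, hS, hspan⟩ := (Submodule.fg_span_iff_fg_span_finset_subset _).1 hfg
  have hS' : ∀ x : S, ∃ t, (x : M) ∈ gr t := fun x => hS x.2
  choose t ht using hS'
  refine ⟨S.card, fun l => t (S.equivFin.symm l), fun l => S.equivFin.symm l,
    fun l => ht _, ?_⟩
  rw [← htop, hspan]
  congr 1
  ext x
  constructor
  · rintro ⟨l, rfl⟩
    exact (S.equivFin.symm l).2
  · exact fun hx => ⟨S.equivFin ⟨x, hx⟩, by simp⟩

theorem GradedDecomp.exists_minimal_cover (G : GradedDecomp k σ gr)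
    [Module.Finite (MvPolynomial σ k) M] :
    ∃ (n : ℕ) (tw : Fin n → ℤ) (aug : (Fin n → MvPolynomial σ k) →ₗ[MvPolynomial σ k] M),
      Function.Surjective aug ∧ (∀ l, aug (Pi.single l 1) ∈ gr (tw l)) ∧
      ∀ z, aug z = 0 → ∀ l, constantCoeff (z l) = 0 := by
  classical
  have hex := G.exists_homogeneous_generators
  obtain ⟨tw, v, hv, hspan⟩ := Nat.find_spec hex
  have hmin := fun m => Nat.find_min hex (m := m)
  generalize Nat.find hex = n at *
  have haug : ∀ l, Fintype.linearCombination (MvPolynomial σ k) v (Pi.single l 1) ∈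
      gr (tw l) := fun l => by
    simpa using hv l
  refine ⟨n, tw, Fintype.linearCombination (MvPolynomial σ k) v, ?_, haug, ?_⟩
  · rw [← LinearMap.range_eq_top, Fintype.range_linearCombination, hspan]
  intro z hz l
  by_contra hc
  obtain ⟨n, rfl⟩ : ∃ m, n = m + 1 := ⟨n - 1, by have := l.2; omega⟩
  refine hmin n (Nat.lt_succ_self n)
    ⟨fun i => tw (l.succAbove i), fun i => v (l.succAbove i), fun i => hv _, ?_⟩
  set y := freeComp tw (tw l) z with hy
  have hy0 : Fintype.linearCombination (MvPolynomial σ k) v y = 0 := by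
    rw [hy, ← G.proj_linearMap haug, hz, map_zero]
  have hyl : y l = C (constantCoeff (z l)) := by
    rw [hy, freeComp_apply, sub_self, homogZ_zero_degree (homogZ_homogCompZ 0 (z l)),
      constantCoeff_homogCompZ_zero]
  rw [Fintype.linearCombination_apply, Fin.sum_univ_succAbove _ l, hyl] at hy0
  rw [eq_top_iff, ← hspan, Submodule.span_le]
  rintro _ ⟨i, rfl⟩
  rcases eq_or_ne i l with rfl | hne
  · have : v i = (C (constantCoeff (z i))⁻¹ : MvPolynomial σ k) •
        -∑ j, y (i.succAbove j) • v (i.succAbove j) := by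
      rw [← eq_neg_of_add_eq_zero_left hy0, smul_smul, ← C_mul, inv_mul_cancel₀ hc, C_1, one_smul]
    rw [SetLike.mem_coe, this]
    exact Submodule.smul_mem _ _ (neg_mem (sum_mem fun j _ =>
      Submodule.smul_mem _ _ (Submodule.subset_span ⟨j, rfl⟩)))
  · obtain ⟨j, rfl⟩ := Fin.exists_succAbove_eq hne
    exact Submodule.subset_span ⟨j, rfl⟩

end MinimalCover

section Syzygies

variable {k : Type} [Field k] {σ : Type}

/-- Exactness of a complex of free modules persists modulo few variables. -/
theorem exists_sub_mem_span_X {rk : ℕ → ℕ}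
    {d : ∀ i, (Fin (rk (i + 1)) → MvPolynomial σ k) →ₗ[MvPolynomial σ k]
      (Fin (rk i) → MvPolynomial σ k)}
    (hd : ∀ i, LinearMap.range (d (i + 1)) = LinearMap.ker (d i)) (S : Finset σ) :
    ∀ i, S.card ≤ i → ∀ z, (∀ l, d i z l ∈ Ideal.span (X '' (S : Set σ))) →
      ∃ w, ∀ l, (z - d (i + 1) w) l ∈
        Ideal.span (X '' (S : Set σ) : Set (MvPolynomial σ k)) := by
  classical
  induction S using Finset.induction_on with
  | empty =>
    intro i _ z hz
    have : d i z = 0 := funext fun l => by simpa using hz l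
    obtain ⟨w, rfl⟩ : z ∈ LinearMap.range (d (i + 1)) := by rwa [hd, LinearMap.mem_ker]
    exact ⟨w, fun l => by simp⟩
  | insert a S ha ih =>
    intro i hi z hz
    rw [Finset.card_insert_of_notMem ha] at hi
    obtain ⟨i, rfl⟩ : ∃ j, i = j + 1 := ⟨i - 1, by omega⟩
    rw [Finset.coe_insert, Set.image_insert_eq] at *
    have hdec : ∀ l, ∃ y, d (i + 1) z l + y * X a ∈
        Ideal.span (X '' (S : Set σ) : Set (MvPolynomial σ k)) :=
      fun l => (Ideal.mem_span_insert' _ _ _).1 (hz l)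
    choose y hy using hdec
    have hdd : ∀ x, d i (d (i + 1) x) = 0 := fun x => by
      rw [← LinearMap.mem_ker, ← hd]
      exact ⟨x, rfl⟩
    have hdy : ∀ l, d i y l ∈ Ideal.span (X '' (S : Set σ) : Set (MvPolynomial σ k)) := by
      intro l
      refine X_mul_mem_span_X_image (by simpa using ha) ?_
      have := linearMap_apply_mem (Ideal.span (X '' (S : Set σ) : Set (MvPolynomial σ k))) (d i)
        (z := d (i + 1) z + (X a : MvPolynomial σ k) • y)
        (fun l => by simpa [mul_comm] using hy l) l
      rw [map_add, hdd, zero_add, map_smul] at this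
      exact this
    obtain ⟨w, hw⟩ := ih i (by omega) y hdy
    obtain ⟨w', hw'⟩ := ih (i + 1) (by omega) (z + (X a : MvPolynomial σ k) • w) (fun l => by
      have h1 := hy l
      have h2 := Ideal.mul_mem_left _ (X a) (hw l)
      convert sub_mem h1 h2 using 1
      simp only [map_add, map_smul, Pi.add_apply, Pi.smul_apply, Pi.sub_apply, smul_eq_mul]
      ring)
    refine ⟨w', fun l => ?_⟩
    have h1 := hw' l
    have hle : Ideal.span (X '' (S : Set σ) : Set (MvPolynomial σ k)) ≤
        Ideal.span (insert (X a) (X '' (S : Set σ))) := Ideal.span_mono (Set.subset_insert _ _)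
    have h2 : X a * w l ∈ Ideal.span (insert (X a) (X '' (S : Set σ))) :=
      Ideal.mul_mem_right _ _ (Ideal.subset_span (Set.mem_insert _ _))
    convert sub_mem (hle h1) h2 using 1
    simp only [Pi.add_apply, Pi.smul_apply, Pi.sub_apply, smul_eq_mul]
    ring

theorem rk_eq_zero_of_minimal [Fintype σ] {rk : ℕ → ℕ}
    {d : ∀ i, (Fin (rk (i + 1)) → MvPolynomial σ k) →ₗ[MvPolynomial σ k]
      (Fin (rk i) → MvPolynomial σ k)}
    (hd : ∀ i, LinearMap.range (d (i + 1)) = LinearMap.ker (d i))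
    (hmin : ∀ i l l', constantCoeff (d i (Pi.single l 1) l') = 0)
    {i : ℕ} (hi : Fintype.card σ < i) : rk i = 0 := by
  obtain ⟨i, rfl⟩ : ∃ j, i = j + 1 := ⟨i - 1, by omega⟩
  by_contra h
  let l : Fin (rk (i + 1)) := ⟨0, Nat.pos_of_ne_zero h⟩
  have hspan : Ideal.span (X '' ((Finset.univ : Finset σ) : Set σ) : Set (MvPolynomial σ k)) =
      maxHomIdeal k σ := by rw [maxHomIdeal, Finset.coe_univ, Set.image_univ]
  obtain ⟨w, hw⟩ := exists_sub_mem_span_X hd Finset.univ i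
    (by rw [Finset.card_univ]; omega) (Pi.single l 1) (fun l' => by
      rw [hspan, mem_maxHomIdeal_iff]
      exact hmin i l l')
  have h1 := hw l
  have h2 := linearMap_apply_mem_of_entries (maxHomIdeal k σ) (d (i + 1))
    (fun l l' => mem_maxHomIdeal_iff.2 (hmin _ l l')) w l
  rw [hspan, Pi.sub_apply, Pi.single_eq_same, mem_maxHomIdeal_iff, map_sub,
    mem_maxHomIdeal_iff.1 h2] at h1
  simp at h1

end Syzygies

section MinimalResolution

variable {k : Type} [Field k] {σ : Type}
variable {M : Type} [AddCommGroup M] [Module (MvPolynomial σ k) M] {gr : ℤ → AddSubgroup M}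

/-- A resolution is minimal if its differentials vanish modulo the maximal homogeneous ideal. -/
def GradedFreeRes.IsMinimal (F : GradedFreeRes k σ M gr) : Prop :=
  ∀ i l l', constantCoeff (F.d i (Pi.single l 1) l') = 0

/-- A graded submodule of a twisted free module, contained in the maximal ideal times it. -/
structure MinimalSyzygy (k : Type) [Field k] (σ : Type) where
  rk : ℕ
  tw : Fin rk → ℤ
  ker : Submodule (MvPolynomial σ k) (Fin rk → MvPolynomial σ k)
  decomp : GradedDecomp k σ (submoduleGr (freeGr tw) ker)
  constantCoeff_eq_zero : ∀ z ∈ ker, ∀ l, constantCoeff (z l) = 0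

theorem MinimalSyzygy.exists_next [Finite σ] (s : MinimalSyzygy k σ) :
    ∃ (s' : MinimalSyzygy k σ)
      (d : (Fin s'.rk → MvPolynomial σ k) →ₗ[MvPolynomial σ k] (Fin s.rk → MvPolynomial σ k)),
      LinearMap.range d = s.ker ∧ LinearMap.ker d = s'.ker ∧
      ∀ l, d (Pi.single l 1) ∈ freeGr s.tw (s'.tw l) := by
  obtain ⟨n, tw, aug, hsurj, haug, hker⟩ := s.decomp.exists_minimal_cover
  refine ⟨⟨n, tw, LinearMap.ker aug, s.decomp.ker haug, hker⟩, s.ker.subtype ∘ₗ aug, ?_, ?_, ?_⟩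
  · rw [LinearMap.range_comp, LinearMap.range_eq_top.2 hsurj, Submodule.map_top,
      Submodule.range_subtype]
  · rw [LinearMap.ker_comp, Submodule.ker_subtype]
    rfl
  · exact haug

theorem GradedDecomp.exists_minimal_resolution [Finite σ] (G : GradedDecomp k σ gr)
    [Module.Finite (MvPolynomial σ k) M] :
    ∃ F : GradedFreeRes k σ M gr, F.IsMinimal := by
  have := Fintype.ofFinite σ
  obtain ⟨n, tw, aug, hsurj, haug, hker⟩ := G.exists_minimal_cover
  choose next d hrange hkerd hhom using MinimalSyzygy.exists_next (k := k) (σ := σ)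
  let s : ℕ → MinimalSyzygy k σ := fun i =>
    Nat.rec ⟨n, tw, LinearMap.ker aug, G.ker haug, hker⟩ (fun _ => next) i
  have hd : ∀ i, LinearMap.range (d (s (i + 1))) = LinearMap.ker (d (s i)) := fun i => by
    rw [hrange, hkerd]
  have hmin : ∀ i l l', constantCoeff (d (s i) (Pi.single l 1) l') = 0 := fun i l l' =>
    (s i).constantCoeff_eq_zero _ (by rw [← hrange]; exact ⟨_, rfl⟩) l'
  exact ⟨{
    rk := fun i => (s i).rk
    tw := fun i => (s i).tw
    bdd := ⟨Fintype.card σ + 1, fun i hi =>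
      rk_eq_zero_of_minimal (rk := fun i => (s i).rk) (d := fun i => d (s i)) hd hmin hi⟩
    aug := aug
    d := fun i => d (s i)
    aug_surj := hsurj
    exact_zero := hrange (s 0)
    exact_succ := hd
    aug_homog := haug
    d_homog := fun i l l' => hhom (s i) l l' }, hmin⟩

end MinimalResolution

theorem exists_dependent_seq {S : ℕ → Type} (P : ∀ n, S n → Prop)
    (rel : ∀ n, S n → S (n + 1) → Prop) {s₀ : S 0} (h₀ : P 0 s₀)
    (step : ∀ n s, P n s → ∃ s', P (n + 1) s' ∧ rel n s s') :
    ∃ f : ∀ n, S n, f 0 = s₀ ∧ (∀ n, P n (f n)) ∧ ∀ n, rel n (f n) (f (n + 1)) := by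
  choose next hP hrel using step
  let f : ∀ n, {s : S n // P n s} := fun n =>
    Nat.rec ⟨s₀, h₀⟩ (fun n s => ⟨next n s.1 s.2, hP n s.1 s.2⟩) n
  exact ⟨fun n => (f n).1, rfl, fun n => (f n).2, fun n => hrel n (f n).1 (f n).2⟩

section Lifting

variable {R L K N : Type} [CommRing R] [AddCommGroup N] [Module R N]

theorem exists_lift_of_basis [Finite L] [DecidableEq L] (f : (L → R) →ₗ[R] N)
    (g : (K → R) →ₗ[R] N) {P : L → (K → R) → Prop}
    (h : ∀ l, ∃ w, P l w ∧ g w = f (Pi.single l 1)) :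
    ∃ φ : (L → R) →ₗ[R] (K → R), g ∘ₗ φ = f ∧ ∀ l, P l (φ (Pi.single l 1)) := by
  have := Fintype.ofFinite L
  choose w hP hw using h
  have hφ : ∀ l, Fintype.linearCombination R w (Pi.single l 1) = w l := fun l => by simp
  refine ⟨Fintype.linearCombination R w, ?_, fun l => (hφ l).symm ▸ hP l⟩
  refine LinearMap.pi_ext' fun l => LinearMap.ext_ring ?_
  simp only [LinearMap.comp_apply, LinearMap.single_apply]
  rw [hφ, hw]

end Lifting

section Comparison

variable {k : Type} [Field k] {σ : Type}

theorem GradedDecomp.exists_graded_lift {L K N : Type} [AddCommGroup N]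
    [Module (MvPolynomial σ k) N] {gr : ℤ → AddSubgroup N} (G : GradedDecomp k σ gr)
    [Finite L] [DecidableEq L] [Finite K] [DecidableEq K] {twL : L → ℤ} {twK : K → ℤ}
    {f : (L → MvPolynomial σ k) →ₗ[MvPolynomial σ k] N}
    {g : (K → MvPolynomial σ k) →ₗ[MvPolynomial σ k] N}
    (hf : ∀ l, f (Pi.single l 1) ∈ gr (twL l)) (hg : ∀ l, g (Pi.single l 1) ∈ gr (twK l))
    (h : ∀ z, f z ∈ LinearMap.range g) :
    ∃ φ : (L → MvPolynomial σ k) →ₗ[MvPolynomial σ k] (K → MvPolynomial σ k),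
      g ∘ₗ φ = f ∧ ∀ l, φ (Pi.single l 1) ∈ freeGr twK (twL l) := by
  refine exists_lift_of_basis f g (P := fun l w => w ∈ freeGr twK (twL l)) fun l => ?_
  obtain ⟨w, hw⟩ := h (Pi.single l 1)
  exact ⟨freeComp twK (twL l) w, (freeDecomp twK).proj_mem _ w, by
    rw [← G.proj_linearMap hg, hw, G.proj_same (hf l)]⟩

variable {M : Type} [AddCommGroup M] [Module (MvPolynomial σ k) M] {gr : ℤ → AddSubgroup M}

theorem GradedFreeRes.d_comp_d (F : GradedFreeRes k σ M gr) (i : ℕ)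
    (z : Fin (F.rk (i + 1 + 1)) → MvPolynomial σ k) : F.d i (F.d (i + 1) z) = 0 := by
  rw [← LinearMap.mem_ker, ← F.exact_succ]
  exact ⟨z, rfl⟩

theorem GradedFreeRes.aug_comp_d (F : GradedFreeRes k σ M gr)
    (z : Fin (F.rk 1) → MvPolynomial σ k) : F.aug (F.d 0 z) = 0 := by
  rw [← LinearMap.mem_ker, ← F.exact_zero]
  exact ⟨z, rfl⟩

theorem GradedFreeRes.exists_graded_chainMap (G : GradedDecomp k σ gr)
    (F H : GradedFreeRes k σ M gr) :
    ∃ φ : ∀ i, (Fin (F.rk i) → MvPolynomial σ k) →ₗ[MvPolynomial σ k]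
        (Fin (H.rk i) → MvPolynomial σ k),
      H.aug ∘ₗ φ 0 = F.aug ∧ (∀ i, H.d i ∘ₗ φ (i + 1) = φ i ∘ₗ F.d i) ∧
      ∀ i l, φ i (Pi.single l 1) ∈ freeGr (H.tw i) (F.tw i l) := by
  obtain ⟨φ₀, h₀, h₀'⟩ := G.exists_graded_lift F.aug_homog H.aug_homog
    (fun z => by rw [LinearMap.range_eq_top.2 H.aug_surj]; trivial)
  obtain ⟨φ, hφ₀, hP, hrel⟩ := exists_dependent_seq
    (S := fun i => (Fin (F.rk i) → MvPolynomial σ k) →ₗ[MvPolynomial σ k]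
        (Fin (H.rk i) → MvPolynomial σ k))
    (fun i φ => (∀ l, φ (Pi.single l 1) ∈ freeGr (H.tw i) (F.tw i l)) ∧
      ∀ z, φ (F.d i z) ∈ LinearMap.range (H.d i))
    (fun i φ φ' => H.d i ∘ₗ φ' = φ ∘ₗ F.d i) (s₀ := φ₀)
    ⟨h₀', fun z => by
      rw [H.exact_zero, LinearMap.mem_ker, ← LinearMap.comp_apply, h₀, F.aug_comp_d]⟩
    (fun i φ hφ => by
      obtain ⟨φ', h, h'⟩ := (freeDecomp (k := k) (H.tw i)).exists_graded_lift
        (twL := F.tw (i + 1)) (f := φ ∘ₗ F.d i) (g := H.d i) (twK := H.tw (i + 1)) (fun l => by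
          have h1 : F.d i (Pi.single l 1) ∈ freeGr (F.tw i) (F.tw (i + 1) l) :=
            fun l' => F.d_homog i l l'
          have h2 : freeComp (F.tw i) (F.tw (i + 1) l) (F.d i (Pi.single l 1)) =
              F.d i (Pi.single l 1) := (freeDecomp (F.tw i)).proj_same h1
          rw [LinearMap.comp_apply, ← h2, ← (freeDecomp (H.tw i)).proj_linearMap hφ.1]
          exact (freeDecomp (H.tw i)).proj_mem _ _)
        (fun l l' => H.d_homog i l l') hφ.2
      refine ⟨φ', ⟨h', fun z => ?_⟩, h⟩
      rw [H.exact_succ, LinearMap.mem_ker, ← LinearMap.comp_apply, h, LinearMap.comp_apply,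
        F.d_comp_d, map_zero])
  exact ⟨φ, by rw [hφ₀, h₀], hrel, fun i => (hP i).1⟩

theorem GradedFreeRes.exists_homotopy (F : GradedFreeRes k σ M gr)
    (θ : ∀ i, (Fin (F.rk i) → MvPolynomial σ k) →ₗ[MvPolynomial σ k]
        (Fin (F.rk i) → MvPolynomial σ k))
    (h₀ : F.aug ∘ₗ θ 0 = 0) (hθ : ∀ i, F.d i ∘ₗ θ (i + 1) = θ i ∘ₗ F.d i) :
    ∃ h : ∀ i, (Fin (F.rk i) → MvPolynomial σ k) →ₗ[MvPolynomial σ k]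
        (Fin (F.rk (i + 1)) → MvPolynomial σ k),
      F.d 0 ∘ₗ h 0 = θ 0 ∧ ∀ i, F.d (i + 1) ∘ₗ h (i + 1) = θ (i + 1) - h i ∘ₗ F.d i := by
  obtain ⟨η₀, hη₀, -⟩ := exists_lift_of_basis (θ 0) (F.d 0) (P := fun _ _ => True) (fun l => by
    obtain ⟨w, hw⟩ : θ 0 (Pi.single l 1) ∈ LinearMap.range (F.d 0) := by
      rw [F.exact_zero, LinearMap.mem_ker, ← LinearMap.comp_apply, h₀, LinearMap.zero_apply]
    exact ⟨w, trivial, hw⟩)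
  obtain ⟨h, hh₀, hP, hrel⟩ := exists_dependent_seq
    (S := fun i => (Fin (F.rk i) → MvPolynomial σ k) →ₗ[MvPolynomial σ k]
        (Fin (F.rk (i + 1)) → MvPolynomial σ k))
    (fun i h => (θ i - F.d i ∘ₗ h) ∘ₗ F.d i = 0)
    (fun i h h' => F.d (i + 1) ∘ₗ h' = θ (i + 1) - h ∘ₗ F.d i) (s₀ := η₀)
    (by rw [hη₀, sub_self, LinearMap.zero_comp])
    (fun i h hP => by
      obtain ⟨h', hh', -⟩ := exists_lift_of_basis (θ (i + 1) - h ∘ₗ F.d i) (F.d (i + 1))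
        (P := fun _ _ => True) (fun l => by
          obtain ⟨w, hw⟩ : (θ (i + 1) - h ∘ₗ F.d i) (Pi.single l 1) ∈
              LinearMap.range (F.d (i + 1)) := by
            rw [F.exact_succ, LinearMap.mem_ker]
            have h1 := LinearMap.congr_fun hP (Pi.single l 1)
            have h2 := LinearMap.congr_fun (hθ i) (Pi.single l 1)
            simp only [LinearMap.comp_apply, LinearMap.sub_apply, LinearMap.zero_apply,
              map_sub] at h1 h2 ⊢
            rw [h2, h1]
          exact ⟨w, trivial, hw⟩)
      refine ⟨h', LinearMap.ext fun z => ?_, hh'⟩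
      rw [hh', sub_sub_cancel]
      simp [F.d_comp_d])
  exact ⟨h, by rw [hh₀, hη₀], hrel⟩

/-- The twists of a minimal resolution occur in every resolution. -/
theorem GradedFreeRes.IsMinimal.exists_tw_eq (G : GradedDecomp k σ gr)
    {F : GradedFreeRes k σ M gr} (hF : F.IsMinimal) (H : GradedFreeRes k σ M gr) (i : ℕ)
    (l : Fin (F.rk i)) : ∃ l', H.tw i l' = F.tw i l := by
  obtain ⟨φ, hφ₀, hφ, hφgr⟩ := F.exists_graded_chainMap G H
  obtain ⟨ψ, hψ₀, hψ, -⟩ := H.exists_graded_chainMap G F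
  obtain ⟨h, hh₀, hh⟩ := F.exists_homotopy (fun i => ψ i ∘ₗ φ i - LinearMap.id)
    (by rw [LinearMap.comp_sub, ← LinearMap.comp_assoc, hψ₀, hφ₀, LinearMap.comp_id, sub_self])
    (fun i => by
      rw [LinearMap.comp_sub, ← LinearMap.comp_assoc, hψ, LinearMap.comp_assoc, hφ,
        LinearMap.sub_comp, LinearMap.comp_id, LinearMap.id_comp, LinearMap.comp_assoc])
  have hd : ∀ i z l, F.d i z l ∈ maxHomIdeal k σ := fun i =>
    linearMap_apply_mem_of_entries _ _ fun l l' => mem_maxHomIdeal_iff.2 (hF i l l')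
  have hθ : ∀ i z l, (ψ i (φ i z) - z) l ∈ maxHomIdeal k σ := by
    intro i z l
    cases i with
    | zero =>
      have := LinearMap.congr_fun hh₀ z
      simp only [LinearMap.comp_apply, LinearMap.sub_apply, LinearMap.id_apply] at this
      rw [← this]
      exact hd _ _ _
    | succ i =>
      have := LinearMap.congr_fun (hh i) z
      simp only [LinearMap.comp_apply, LinearMap.sub_apply, LinearMap.id_apply] at this
      rw [← sub_add_cancel (ψ (i + 1) (φ (i + 1) z) - z) (h i (F.d i z)), ← this]
      exact add_mem (hd _ _ _) (linearMap_apply_mem _ (h i) (hd i z) l)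
  by_contra! hne
  have hφm : ∀ l', φ i (Pi.single l 1) l' ∈ maxHomIdeal k σ := fun l' => by
    rw [mem_maxHomIdeal_iff]
    by_contra hc
    have := (hφgr i l l').eq_zero_of_constantCoeff_ne_zero hc
    exact hne l' (by omega)
  have h1 := sub_mem (linearMap_apply_mem _ (ψ i) hφm l) (hθ i (Pi.single l 1) l)
  rw [← Pi.sub_apply, sub_sub_cancel, Pi.single_eq_same, mem_maxHomIdeal_iff] at h1
  simp at h1

theorem GradedFreeRes.IsMinimal.regM_eq (G : GradedDecomp k σ gr)
    {F : GradedFreeRes k σ M gr} (hF : F.IsMinimal) {ρ : ℤ}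
    (hle : ∀ i l, F.tw i l - i ≤ ρ) (heq : ∃ i l, F.tw i l - (i : ℤ) = ρ) :
    regM k σ M gr = ρ := by
  obtain ⟨i, l, heq⟩ := heq
  refine IsLeast.csInf_eq ⟨⟨F, hle⟩, ?_⟩
  rintro r ⟨H, hH⟩
  obtain ⟨l', hl'⟩ := hF.exists_tw_eq G H i l
  have := hH i l'
  omega

theorem GradedFreeRes.rk_zero_ne_zero [Nontrivial M] (F : GradedFreeRes k σ M gr) :
    F.rk 0 ≠ 0 := by
  intro h
  have : IsEmpty (Fin (F.rk 0)) := by rw [h]; infer_instance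
  have := F.aug_surj.subsingleton
  exact not_subsingleton M this

theorem GradedFreeRes.exists_max_tw [Nontrivial M] (F : GradedFreeRes k σ M gr) :
    ∃ i l, ∀ j l', F.tw j l' - (j : ℤ) ≤ F.tw i l - i := by
  obtain ⟨N, hN⟩ := F.bdd
  have hlt : ∀ x : Σ i, Fin (F.rk i), x.1 < N := fun x => by
    by_contra! hx
    have h1 := x.2.2
    have h2 := hN _ hx
    omega
  have : Finite (Σ i, Fin (F.rk i)) := Finite.of_injective
    (β := Σ i : Fin N, Fin (F.rk i)) (fun x => ⟨⟨x.1, hlt x⟩, x.2⟩) (by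
      rintro ⟨i, l⟩ ⟨j, l'⟩ h
      simp only [Sigma.mk.injEq, Fin.mk.injEq] at h
      obtain ⟨rfl, h⟩ := h
      rw [eq_of_heq h])
  have : Nonempty (Σ i, Fin (F.rk i)) := ⟨⟨0, ⟨0, Nat.pos_of_ne_zero F.rk_zero_ne_zero⟩⟩⟩
  obtain ⟨⟨i, l⟩, h⟩ := Finite.exists_max fun x : Σ i, Fin (F.rk i) => F.tw x.1 x.2 - (x.1 : ℤ)
  exact ⟨i, l, fun j l' => h ⟨j, l'⟩⟩

end Comparison

section ExtCocycles

open CategoryTheory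

variable {R : Type} [CommRing R] {M N : ModuleCat.{0} R}

/-- `f` is a cocycle of the complex `Hom(P, M)`. -/
def IsCocycle (P : ChainComplex (ModuleCat.{0} R) ℕ) (i : ℕ) (f : P.X i ⟶ M) : Prop :=
  ∀ j, P.d j i ≫ f = 0

/-- `f` is a coboundary of the complex `Hom(P, M)`. -/
def IsCoboundary (P : ChainComplex (ModuleCat.{0} R) ℕ) (i : ℕ) (f : P.X i ⟶ M) : Prop :=
  ∃ (j : ℕ) (g : P.X j ⟶ M), P.d i j ≫ g = f

variable {P Q : ChainComplex (ModuleCat.{0} R) ℕ} {i : ℕ}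

theorem IsCocycle.comp {f : P.X i ⟶ M} (hf : IsCocycle P i f) (u : M ⟶ N) :
    IsCocycle P i (f ≫ u) := fun j => by rw [← Category.assoc, hf j, Limits.zero_comp]

theorem IsCocycle.of_comp_mono {f : P.X i ⟶ M} (u : M ⟶ N) [Mono u]
    (hf : IsCocycle P i (f ≫ u)) : IsCocycle P i f := fun j => by
  rw [← cancel_mono u, Category.assoc, hf j, Limits.zero_comp]

theorem IsCocycle.chainMap {f : P.X i ⟶ M} (hf : IsCocycle P i f) (φ : Q ⟶ P) :
    IsCocycle Q i (φ.f i ≫ f) := fun j => by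
  rw [← Category.assoc, ← φ.comm, Category.assoc, hf, Limits.comp_zero]

theorem isCoboundary_zero : IsCoboundary P i (0 : P.X i ⟶ M) := ⟨i, 0, by simp⟩

theorem IsCoboundary.comp {f : P.X i ⟶ M} (hf : IsCoboundary P i f) (u : M ⟶ N) :
    IsCoboundary P i (f ≫ u) := by
  obtain ⟨j, g, rfl⟩ := hf
  exact ⟨j, g ≫ u, by simp⟩

theorem IsCoboundary.exists_succ {f : P.X (i + 1) ⟶ M} (hf : IsCoboundary P (i + 1) f) :
    ∃ g : P.X i ⟶ M, P.d (i + 1) i ≫ g = f := by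
  obtain ⟨j, g, rfl⟩ := hf
  by_cases h : j = i
  · subst h
    exact ⟨g, rfl⟩
  · refine ⟨0, ?_⟩
    rw [P.shape (i + 1) j (by simpa using h)]
    simp

theorem isCoboundary_zero_iff {f : P.X 0 ⟶ M} : IsCoboundary P 0 f ↔ f = 0 := by
  constructor
  · rintro ⟨j, g, rfl⟩
    rw [P.shape 0 j (by simp), Limits.zero_comp]
  · rintro rfl
    exact isCoboundary_zero

theorem IsCoboundary.add {f f' : P.X i ⟶ M} (hf : IsCoboundary P i f)
    (hf' : IsCoboundary P i f') : IsCoboundary P i (f + f') := by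
  cases i with
  | zero =>
    rw [isCoboundary_zero_iff] at *
    rw [hf, hf', add_zero]
  | succ i =>
    obtain ⟨g, rfl⟩ := hf.exists_succ
    obtain ⟨g', rfl⟩ := hf'.exists_succ
    exact ⟨i, g + g', by simp⟩

theorem IsCoboundary.sum {ι : Type} (s : Finset ι) {f : ι → (P.X i ⟶ M)}
    (hf : ∀ a ∈ s, IsCoboundary P i (f a)) : IsCoboundary P i (∑ a ∈ s, f a) := by
  classical
  induction s using Finset.induction_on with
  | empty => exact isCoboundary_zero
  | insert a s ha ih =>
    rw [Finset.sum_insert ha]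
    exact (hf a (by simp)).add (ih fun b hb => hf b (by simp [hb]))

end ExtCocycles

section ExtDepth

open CategoryTheory

variable {R : Type} [CommRing R] (C : ℕ → ChainComplex (ModuleCat.{0} R) ℕ)

/-- The cohomology of `Hom(C n, M)` in degree `i` vanishes for all `n`. -/
def ExtVanishes (i : ℕ) (M : ModuleCat.{0} R) : Prop :=
  ∀ n (f : (C n).X i ⟶ M), IsCocycle (C n) i f → IsCoboundary (C n) i f

variable {C} {φ : ∀ n, C n ⟶ C 0}

variable (φ) in
/-- A cocycle on `C 0` whose pullback to every `C n` has nontrivial class. -/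
def IsPersistentCocycle {M : ModuleCat.{0} R} (i : ℕ) (f : (C 0).X i ⟶ M) : Prop :=
  IsCocycle (C 0) i f ∧ ∀ n, ¬ IsCoboundary (C n) i ((φ n).f i ≫ f)

variable (φ) in
/-- The lowest degree in which `colim H(Hom(C n, M))` is nontrivial is `e`. -/
def HasExtDepth (e : ℕ) (M : ModuleCat.{0} R) : Prop :=
  (∀ i < e, ExtVanishes C i M) ∧ ∃ f : (C 0).X e ⟶ M, IsPersistentCocycle φ e f

theorem HasExtDepth.of_iso {e : ℕ} {M N : ModuleCat.{0} R} (h : HasExtDepth φ e M) (u : M ≅ N) :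
    HasExtDepth φ e N := by
  obtain ⟨hv, f, hf, hnv⟩ := h
  refine ⟨fun i hi n g hg => ?_, f ≫ u.hom, hf.comp _, fun n hn => hnv n ?_⟩
  · simpa using (hv i hi n _ (hg.comp u.inv)).comp u.hom
  · simpa using hn.comp u.inv

variable [hproj : ∀ n i, Projective ((C n).X i)]

/-- The connecting homomorphism in degrees where it is injective. -/
theorem isCoboundary_of_comp_mono {S : ShortComplex (ModuleCat.{0} R)} (hS : S.ShortExact)
    {i n : ℕ} (hv : ∀ j < i, ExtVanishes C j S.X₃) {f : (C n).X i ⟶ S.X₁}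
    (hf : IsCoboundary (C n) i (f ≫ S.f)) : IsCoboundary (C n) i f := by
  have := hS.mono_f
  have := hS.epi_g
  cases i with
  | zero =>
    rw [isCoboundary_zero_iff] at *
    rwa [← cancel_mono S.f, Limits.zero_comp]
  | succ i =>
    obtain ⟨h, hh⟩ := hf.exists_succ
    have hc : IsCocycle (C n) i (h ≫ S.g) := fun j => by
      by_cases hj : j = i + 1
      · subst hj
        rw [← Category.assoc, hh, Category.assoc, S.zero, Limits.comp_zero]
      · rw [(C n).shape j i (by simpa [eq_comm] using hj), Limits.zero_comp]
    obtain ⟨j, g, hg⟩ := hv i (Nat.lt_succ_self i) n _ hc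
    have hker : (h - (C n).d i j ≫ Projective.factorThru g S.g) ≫ S.g = 0 := by
      simp [hg]
    refine ⟨i, hS.exact.lift _ hker, ?_⟩
    rw [← cancel_mono S.f, Category.assoc, hS.exact.lift_f, Preadditive.comp_sub, hh,
      ← Category.assoc ((C n).d _ _), (C n).d_comp_d, Limits.zero_comp, sub_zero]

theorem HasExtDepth.succ {e : ℕ} {M N : ModuleCat.{0} R} {x : R} {q : M ⟶ N}
    {w : (x • 𝟙 M) ≫ q = 0} (hS : (ShortComplex.mk (x • 𝟙 M) q w).ShortExact)
    (hnull : ∀ n i (f : (C n).X i ⟶ M), IsCocycle (C n) i f →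
      IsCoboundary (C n) i (x ^ (n + 1) • f))
    (h : HasExtDepth φ e N) : HasExtDepth φ (e + 1) M := by
  obtain ⟨hv, g, hg, hnv⟩ := h
  have := hS.mono_f
  have := hS.epi_g
  have hv' : ∀ i < e + 1, ExtVanishes C i M := by
    intro i hi n f hf
    have key : ∀ m, IsCoboundary (C n) i (x ^ m • f) → IsCoboundary (C n) i f := by
      intro m
      induction m with
      | zero => simp
      | succ m ih =>
        intro hm
        refine ih (isCoboundary_of_comp_mono hS (fun j hj => hv j (by omega)) ?_)
        simpa [smul_smul, pow_succ'] using hm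
    exact key _ (hnull n i f hf)
  have hcg : (C 0).d (e + 1) e ≫ Projective.factorThru g q ≫ q = 0 := by
    rw [Projective.factorThru_comp, hg]
  let f := hS.exact.lift ((C 0).d (e + 1) e ≫ Projective.factorThru g q)
    (by rw [Category.assoc, hcg])
  have hf : f ≫ (x • 𝟙 M) = (C 0).d (e + 1) e ≫ Projective.factorThru g q :=
    hS.exact.lift_f _ _
  refine ⟨hv', f, ?_, fun n hn => hnv n ?_⟩
  · refine IsCocycle.of_comp_mono (x • 𝟙 M) (fun j => ?_)
    rw [hf, ← Category.assoc, (C 0).d_comp_d, Limits.zero_comp]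
  · obtain ⟨h, hh⟩ := hn.exists_succ
    have hc : IsCocycle (C n) e ((φ n).f e ≫ Projective.factorThru g q - h ≫ (x • 𝟙 M)) := by
      intro j
      by_cases hj : j = e + 1
      · subst hj
        rw [Preadditive.comp_sub, ← Category.assoc _ h, hh, Category.assoc, hf,
          (φ n).comm_assoc, sub_self]
      · rw [(C n).shape j e (by simpa [eq_comm] using hj), Limits.zero_comp]
    have hb := (hv' e (Nat.lt_succ_self e) n _ hc).comp q
    rwa [Preadditive.sub_comp, Category.assoc, Category.assoc, w, Limits.comp_zero, sub_zero,
      Projective.factorThru_comp] at hb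

theorem HasExtDepth.pred {S : ShortComplex (ModuleCat.{0} R)} (hS : S.ShortExact) {e : ℕ}
    (hv : ∀ i ≤ e, ExtVanishes C i S.X₁) {f : (C 0).X (e + 1) ⟶ S.X₁}
    (hf : IsPersistentCocycle φ (e + 1) f) (hfb : IsCoboundary (C 0) (e + 1) (f ≫ S.f))
    (hF : ∀ i ≤ e, ExtVanishes C i S.X₂) : HasExtDepth φ e S.X₃ := by
  have := hS.mono_f
  have := hS.epi_g
  refine ⟨fun i hi n f hf => ?_, ?_⟩
  · have hc : ((C n).d (i + 1) i ≫ Projective.factorThru f S.g) ≫ S.g = 0 := by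
      rw [Category.assoc, Projective.factorThru_comp, hf]
    have hlift := hS.exact.lift_f _ hc
    have hg : IsCocycle (C n) (i + 1) (hS.exact.lift _ hc) := by
      refine IsCocycle.of_comp_mono S.f fun j => ?_
      rw [hlift, ← Category.assoc, (C n).d_comp_d, Limits.zero_comp]
    obtain ⟨h, hh⟩ := (hv (i + 1) hi n _ hg).exists_succ
    have hc' : IsCocycle (C n) i (Projective.factorThru f S.g - h ≫ S.f) := by
      intro j
      by_cases hj : j = i + 1
      · subst hj
        rw [Preadditive.comp_sub, ← Category.assoc _ h, hh, hlift, sub_self]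
      · rw [(C n).shape j i (by simpa [eq_comm] using hj), Limits.zero_comp]
    simpa using (hF i hi.le n _ hc').comp S.g
  · obtain ⟨h, hh⟩ := hfb.exists_succ
    refine ⟨h ≫ S.g, fun j => ?_, fun n hn => hf.2 n ?_⟩
    · by_cases hj : j = e + 1
      · subst hj
        rw [← Category.assoc, hh, Category.assoc, S.zero, Limits.comp_zero]
      · rw [(C 0).shape j e (by simpa [eq_comm] using hj), Limits.zero_comp]
    · obtain ⟨j, g, hg⟩ := hn
      have hker : ((φ n).f e ≫ h - (C n).d e j ≫ Projective.factorThru g S.g) ≫ S.g = 0 := by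
        simp [hg]
      refine ⟨e, hS.exact.lift _ hker, ?_⟩
      rw [← cancel_mono S.f, Category.assoc, hS.exact.lift_f, Preadditive.comp_sub,
        ← Category.assoc ((C n).d _ _) ((C n).d _ _), (C n).d_comp_d, Limits.zero_comp, sub_zero,
        ← (φ n).comm_assoc, hh, Category.assoc]

end ExtDepth

section PowerResolutions

open CategoryTheory

variable {R : Type} [CommRing R] (J : Ideal R)

/-- The inverse system of the quotients `R ⧸ J ^ n`. -/
noncomputable abbrev quotPow : ℕᵒᵖ ⥤ ModuleCat.{0} R :=
  localCohomology.ringModIdeals (localCohomology.idealPowersDiagram J)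

/-- A projective resolution of `R ⧸ J ^ (n + 1)`. -/
noncomputable def powRes (n : ℕ) : ProjectiveResolution ((quotPow J).obj (.op (n + 1))) :=
  projectiveResolution _

/-- The lift of the projection `R ⧸ J ^ (n + 1) ⟶ R ⧸ J` to projective resolutions. -/
noncomputable def powTrans (n : ℕ) : (powRes J n).complex ⟶ (powRes J 0).complex :=
  ProjectiveResolution.lift ((quotPow J).map (homOfLE (Nat.le_add_left (0 + 1) n)).op) _ _

instance (n i : ℕ) : Projective ((fun n => (powRes J n).complex) n |>.X i) :=
  (powRes J n).projective i

variable {J}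

theorem isCoboundary_smul {n : ℕ} {a : R} (ha : a ∈ J ^ (n + 1)) {i : ℕ} {M : ModuleCat.{0} R}
    {f : (powRes J n).complex.X i ⟶ M} (hf : IsCocycle (powRes J n).complex i f) :
    IsCoboundary (powRes J n).complex i (a • f) := by
  have hcomm : (a • 𝟙 (powRes J n).complex) ≫ (powRes J n).π = 0 := by
    ext x
    have hz : ∀ y : R ⧸ J ^ (n + 1), a • y = 0 := fun y => by
      obtain ⟨y, rfl⟩ := Submodule.Quotient.mk_surjective _ y
      rw [← Submodule.Quotient.mk_smul, Submodule.Quotient.mk_eq_zero]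
      exact Ideal.mul_mem_right _ _ ha
    exact (map_smul ((powRes J n).π.f 0).hom a x).trans (hz _)
  have h := (ProjectiveResolution.liftHomotopyZero _ hcomm).comm i
  have h' : a • f = (a • 𝟙 (powRes J n).complex).f i ≫ f := by simp
  rw [h', h]
  simp only [HomologicalComplex.zero_f, add_zero, Preadditive.add_comp]
  refine IsCoboundary.add ⟨_, _, (Category.assoc _ _ _).symm⟩ ?_
  convert isCoboundary_zero
  simp only [prevD, AddMonoidHom.mk'_apply, Category.assoc]
  rw [hf, Limits.comp_zero]

theorem hasExtDepth_zero [Nontrivial (R ⧸ J ^ (0 + 1))] :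
    HasExtDepth (powTrans J) 0 (ModuleCat.of R (R ⧸ J ^ (0 + 1))) := by
  refine ⟨fun i hi => by omega, (powRes J 0).π.f 0, fun j => ?_, fun n hn => ?_⟩
  · by_cases hj : j = 1
    · subst hj
      exact (powRes J 0).complex_d_comp_π_f_zero
    · have h := (powRes J 0).complex.shape j 0 (by simpa [eq_comm] using hj)
      exact (congrArg (· ≫ (powRes J 0).π.f 0) h).trans Limits.zero_comp
  · rw [isCoboundary_zero_iff] at hn
    have hn := (ProjectiveResolution.lift_commutes_zero
      ((quotPow J).map (homOfLE (Nat.le_add_left (0 + 1) n)).op) (powRes J n) _).symm.trans hn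
    have hsurj : Function.Surjective ((powRes J n).π.f 0) :=
      (ModuleCat.epi_iff_surjective _).1 inferInstance
    obtain ⟨x, hx⟩ := hsurj (Ideal.Quotient.mk (J ^ (n + 1)) 1)
    have h1 := ConcreteCategory.congr_hom hn x
    have h2 : (Ideal.Quotient.mk (J ^ (0 + 1)) 1 : R ⧸ J ^ (0 + 1)) = 0 :=
      (congrArg ((quotPow J).map (homOfLE (Nat.le_add_left (0 + 1) n)).op) hx).symm.trans h1
    exact one_ne_zero h2

theorem ExtVanishes.pi {i : ℕ}
    (h : ExtVanishes (fun n => (powRes J n).complex) i (ModuleCat.of R R)) (L : Type) [Finite L] :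
    ExtVanishes (fun n => (powRes J n).complex) i (ModuleCat.of R (L → R)) := by
  classical
  have := Fintype.ofFinite L
  let s (l : L) : ModuleCat.of R R ⟶ ModuleCat.of R (L → R) :=
    ModuleCat.ofHom (LinearMap.single R (fun _ : L => R) l)
  let p (l : L) : ModuleCat.of R (L → R) ⟶ ModuleCat.of R R := ModuleCat.ofHom (LinearMap.proj l)
  have hsum : ∑ l, p l ≫ s l = 𝟙 _ := by
    ext z
    simp [p, s, ModuleCat.hom_sum]
  intro n g hg
  rw [← Category.comp_id g, ← hsum, Preadditive.comp_sum]
  refine IsCoboundary.sum _ fun l _ => ?_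
  rw [← Category.assoc]
  exact (h n _ (hg.comp (p l))).comp (s l)

theorem HasExtDepth.pi {e : ℕ} (h : HasExtDepth (powTrans J) e (ModuleCat.of R R))
    (L : Type) [Finite L] [Nonempty L] :
    HasExtDepth (powTrans J) e (ModuleCat.of R (L → R)) := by
  classical
  obtain ⟨hv, f, hf, hnv⟩ := h
  obtain ⟨l⟩ := ‹Nonempty L›
  refine ⟨fun i hi => (hv i hi).pi L,
    f ≫ ModuleCat.ofHom (LinearMap.single R (fun _ : L => R) l), hf.comp _, fun n hn => hnv n ?_⟩
  have hsp : ModuleCat.ofHom (LinearMap.single R (fun _ : L => R) l) ≫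
      ModuleCat.ofHom (LinearMap.proj l) = 𝟙 (ModuleCat.of R R) := by
    ext
    simp
  have := hn.comp (ModuleCat.ofHom (LinearMap.proj l : (L → R) →ₗ[R] R))
  rwa [Category.assoc, Category.assoc, hsp, Category.comp_id] at this

theorem isCoboundary_comp_of_entries {L K : Type} [Finite L] [DecidableEq L] [Finite K]
    {D : (L → R) →ₗ[R] (K → R)} (hD : ∀ l l', D (Pi.single l 1) l' ∈ J) {i : ℕ}
    {f : (powRes J 0).complex.X i ⟶ ModuleCat.of R (L → R)}
    (hf : IsCocycle (powRes J 0).complex i f) :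
    IsCoboundary (powRes J 0).complex i (f ≫ ModuleCat.ofHom D) := by
  classical
  have := Fintype.ofFinite L
  have := Fintype.ofFinite K
  have hsum : ModuleCat.ofHom D = ∑ l, ∑ l', D (Pi.single l 1) l' •
      ModuleCat.ofHom (LinearMap.single R (fun _ : K => R) l' ∘ₗ LinearMap.proj l) := by
    ext l l'
    simp [ModuleCat.hom_sum, Finset.sum_apply, Pi.single_apply]
  rw [hsum, Preadditive.comp_sum]
  refine IsCoboundary.sum _ fun l _ => ?_
  rw [Preadditive.comp_sum]
  refine IsCoboundary.sum _ fun l' _ => ?_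
  rw [Linear.comp_smul]
  exact isCoboundary_smul (by simpa using hD l l') (hf.comp _)

end PowerResolutions

section AuslanderBuchsbaum

open CategoryTheory

variable {k : Type} [Field k] {σ : Type}

instance maxHomIdeal_pow_quotient_nontrivial :
    Nontrivial (MvPolynomial σ k ⧸ maxHomIdeal k σ ^ (0 + 1)) := by
  rw [zero_add, pow_one]
  refine Ideal.Quotient.nontrivial_iff.2 fun h => ?_
  have h1 : (1 : MvPolynomial σ k) ∈ maxHomIdeal k σ := h ▸ Submodule.mem_top
  simp [mem_maxHomIdeal_iff] at h1

theorem shortExact_span_X_insert [DecidableEq σ] {S : Finset σ} {a : σ} (ha : a ∉ S) :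
    ∃ (q : ModuleCat.of (MvPolynomial σ k) (MvPolynomial σ k ⧸
          (Ideal.span (X '' (S : Set σ)) : Ideal (MvPolynomial σ k))) ⟶
        ModuleCat.of (MvPolynomial σ k) (MvPolynomial σ k ⧸
          (Ideal.span (X '' (insert a S : Finset σ)) : Ideal (MvPolynomial σ k))))
      (w : ((X a : MvPolynomial σ k) • 𝟙 _) ≫ q = 0),
      (ShortComplex.mk ((X a : MvPolynomial σ k) • 𝟙 _) q w).ShortExact := by
  set I : Ideal (MvPolynomial σ k) := Ideal.span (X '' (S : Set σ))
  set I' : Ideal (MvPolynomial σ k) := Ideal.span (X '' (insert a S : Finset σ)) with hI'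
  have hins : I' = Ideal.span {X a} ⊔ I := by
    rw [hI', Finset.coe_insert, Set.image_insert_eq, Ideal.span_insert]
  have hle : I ≤ I' := hins ▸ le_sup_right
  have hX : (X a : MvPolynomial σ k) ∈ I' :=
    hins ▸ Ideal.mem_sup_left (Ideal.subset_span rfl)
  let q : (MvPolynomial σ k ⧸ I) →ₗ[MvPolynomial σ k] (MvPolynomial σ k ⧸ I') :=
    Submodule.mapQ I I' LinearMap.id hle
  have hq : ∀ p, q (Submodule.Quotient.mk p) = Submodule.Quotient.mk p := fun p => rfl
  have hker : ∀ y : MvPolynomial σ k ⧸ I, q y = 0 ↔ ∃ z, (X a : MvPolynomial σ k) • z = y := by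
    intro y
    obtain ⟨p, rfl⟩ := Submodule.Quotient.mk_surjective _ y
    rw [hq, Submodule.Quotient.mk_eq_zero]
    constructor
    · intro hp
      rw [hins] at hp
      obtain ⟨u, hu, v, hv, rfl⟩ := Submodule.mem_sup.1 hp
      obtain ⟨z, rfl⟩ := Ideal.mem_span_singleton.1 hu
      refine ⟨Submodule.Quotient.mk z, ?_⟩
      rw [← Submodule.Quotient.mk_smul, Submodule.Quotient.eq, smul_eq_mul]
      simpa using hv
    · rintro ⟨z, hz⟩
      obtain ⟨z, rfl⟩ := Submodule.Quotient.mk_surjective _ z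
      rw [← Submodule.Quotient.mk_smul, Submodule.Quotient.eq, smul_eq_mul] at hz
      have := I'.sub_mem (I'.mul_mem_right z hX) (hle hz)
      rwa [sub_sub_cancel] at this
  have hinj : ∀ y : MvPolynomial σ k ⧸ I, (X a : MvPolynomial σ k) • y = 0 → y = 0 := by
    intro y hy
    obtain ⟨p, rfl⟩ := Submodule.Quotient.mk_surjective _ y
    rw [← Submodule.Quotient.mk_smul, Submodule.Quotient.mk_eq_zero] at hy
    exact (Submodule.Quotient.mk_eq_zero _).2 (X_mul_mem_span_X_image (by simpa using ha) hy)
  refine ⟨ModuleCat.ofHom q, ?_, ModuleCat.shortComplex_shortExact _ ?_ ?_ ?_⟩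
  · exact ModuleCat.hom_ext (LinearMap.ext fun y => (hker _).2 ⟨y, rfl⟩)
  · intro y
    exact hker y
  · exact (injective_iff_map_eq_zero ((X a : MvPolynomial σ k) • LinearMap.id :
      (MvPolynomial σ k ⧸ I) →ₗ[MvPolynomial σ k] (MvPolynomial σ k ⧸ I))).2 fun y => hinj y
  · intro y
    obtain ⟨p, rfl⟩ := Submodule.Quotient.mk_surjective _ y
    exact ⟨Submodule.Quotient.mk p, rfl⟩

theorem hasExtDepth_quotient_span_X [Fintype σ] (n : ℕ) :
    ∀ S : Finset σ, S.card + n = Fintype.card σ →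
      HasExtDepth (powTrans (maxHomIdeal k σ)) n (ModuleCat.of (MvPolynomial σ k)
        (MvPolynomial σ k ⧸ (Ideal.span (X '' (S : Set σ)) : Ideal (MvPolynomial σ k)))) := by
  classical
  induction n with
  | zero =>
    intro S hS
    obtain rfl : S = Finset.univ := Finset.eq_univ_of_card _ hS
    refine hasExtDepth_zero.of_iso (Submodule.quotEquivOfEq _ _ ?_).toModuleIso
    rw [zero_add, pow_one, maxHomIdeal, Finset.coe_univ, Set.image_univ]
  | succ n ih =>
    intro S hS
    obtain ⟨a, ha⟩ : ∃ a, a ∉ S := by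
      by_contra! h
      rw [Finset.eq_univ_of_forall h, Finset.card_univ] at hS
      omega
    obtain ⟨q, w, hq⟩ := shortExact_span_X_insert (k := k) ha
    refine HasExtDepth.succ hq (fun m i f hf => isCoboundary_smul ?_ hf)
      (ih (insert a S) (by rw [Finset.card_insert_of_notMem ha]; omega))
    exact Ideal.pow_mem_pow (mem_maxHomIdeal_iff.2 (by simp)) _

/-- A polynomial ring in `c` variables has depth `c`. -/
theorem hasExtDepth_self [Fintype σ] :
    HasExtDepth (powTrans (maxHomIdeal k σ)) (Fintype.card σ)
      (ModuleCat.of (MvPolynomial σ k) (MvPolynomial σ k)) := by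
  refine (hasExtDepth_quotient_span_X (k := k) (Fintype.card σ) ∅ (by simp)).of_iso
    (LinearEquiv.toModuleIso (Submodule.quotEquivOfEqBot _ ?_))
  simp

variable {M : Type} [AddCommGroup M] [Module (MvPolynomial σ k) M] {gr : ℤ → AddSubgroup M}

theorem GradedFreeRes.shortExact_range (F : GradedFreeRes k σ M gr) (i : ℕ) :
    ∃ w : ModuleCat.ofHom (LinearMap.range (F.d (i + 1))).subtype ≫
        ModuleCat.ofHom (F.d i).rangeRestrict = 0,
      (ShortComplex.mk _ _ w).ShortExact := by
  have hd : (F.d i).rangeRestrict ∘ₗ (LinearMap.range (F.d (i + 1))).subtype = 0 := by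
    refine LinearMap.ext ?_
    rintro ⟨_, z, rfl⟩
    exact Subtype.ext (F.d_comp_d i z)
  refine ⟨ModuleCat.hom_ext hd, ModuleCat.shortComplex_shortExact _ ?_ Subtype.val_injective
    (F.d i).surjective_rangeRestrict⟩
  · intro z
    change (F.d i).rangeRestrict z = 0 ↔ _
    rw [← LinearMap.mem_ker, LinearMap.ker_rangeRestrict, ← F.exact_succ]
    exact ⟨fun h => ⟨⟨z, h⟩, rfl⟩, by rintro ⟨y, rfl⟩; exact y.2⟩

theorem GradedFreeRes.shortExact_aug (F : GradedFreeRes k σ M gr) :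
    ∃ w : ModuleCat.ofHom (LinearMap.range (F.d 0)).subtype ≫ ModuleCat.ofHom F.aug = 0,
      (ShortComplex.mk _ _ w).ShortExact := by
  refine ⟨?_, ModuleCat.shortComplex_shortExact _ ?_ Subtype.val_injective F.aug_surj⟩
  · ext ⟨_, z, rfl⟩
    exact F.aug_comp_d z
  · intro z
    change F.aug z = 0 ↔ _
    rw [← LinearMap.mem_ker, ← F.exact_zero]
    exact ⟨fun h => ⟨⟨z, h⟩, rfl⟩, by rintro ⟨y, rfl⟩; exact y.2⟩

variable [Fintype σ]

theorem GradedFreeRes.IsMinimal.hasExtDepth_range {F : GradedFreeRes k σ M gr} (hF : F.IsMinimal)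
    {p : ℕ} (hp : F.rk (p + 1) ≠ 0) (hz : F.rk (p + 1 + 1) = 0) (j : ℕ) :
    ∀ i e : ℕ, i + j = p → e + j = Fintype.card σ →
      (∀ m < e, ExtVanishes (fun n => (powRes (maxHomIdeal k σ) n).complex) m
        (ModuleCat.of _ (LinearMap.range (F.d i)))) ∧
      ∃ f : (powRes (maxHomIdeal k σ) 0).complex.X e ⟶
          ModuleCat.of _ (LinearMap.range (F.d i)),
        IsPersistentCocycle (powTrans (maxHomIdeal k σ)) e f ∧
        IsCoboundary (powRes (maxHomIdeal k σ) 0).complex e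
          (f ≫ ModuleCat.ofHom (LinearMap.range (F.d i)).subtype) := by
  induction j with
  | zero =>
    rintro i e rfl rfl
    have hinj : Function.Injective (F.d i) := by
      rw [← LinearMap.ker_eq_bot, ← F.exact_succ, LinearMap.range_eq_bot]
      have : IsEmpty (Fin (F.rk (i + 1 + 1))) := by
        rw [hz]
        infer_instance
      exact Subsingleton.elim _ _
    have : Nonempty (Fin (F.rk (i + 1))) := ⟨⟨0, Nat.pos_of_ne_zero hp⟩⟩
    have hd := (hasExtDepth_self (k := k) (σ := σ)).pi (Fin (F.rk (i + 1)))
    let u := (LinearEquiv.ofInjective (F.d i) hinj).toModuleIso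
    refine ⟨(hd.of_iso u).1, ?_⟩
    obtain ⟨-, f, hf, hn⟩ := hd
    refine ⟨f ≫ u.hom, ⟨hf.comp _, fun n h => hn n ?_⟩, ?_⟩
    · simpa using h.comp u.inv
    · rw [Category.assoc]
      exact isCoboundary_comp_of_entries (fun l l' => mem_maxHomIdeal_iff.2 (hF i l l')) hf
  | succ j ih =>
    intro i e hi he
    obtain ⟨hv, f, hf, hb⟩ := ih (i + 1) (e + 1) (by omega) (by omega)
    obtain ⟨w, hS⟩ := F.shortExact_range i
    have hfree (l : ℕ) (m : ℕ) (hm : m ≤ e) := (hasExtDepth_self (k := k) (σ := σ)).1 m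
      (by omega) |>.pi (Fin (F.rk l))
    obtain ⟨hv', g, hg⟩ := HasExtDepth.pred hS (fun m hm => hv m (by omega)) hf hb (hfree _)
    exact ⟨hv', g, hg, hfree i e le_rfl 0 _ (hg.1.comp _)⟩

/-- The Auslander–Buchsbaum formula: `e + p = c` where `p` is the length of a minimal resolution
and `c` the number of variables. -/
theorem GradedFreeRes.IsMinimal.hasExtDepth {F : GradedFreeRes k σ M gr} (hF : F.IsMinimal)
    {p e : ℕ} (hp : F.rk p ≠ 0) (hz : F.rk (p + 1) = 0) (he : e + p = Fintype.card σ) :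
    HasExtDepth (powTrans (maxHomIdeal k σ)) e (ModuleCat.of _ M) := by
  have hself := hasExtDepth_self (k := k) (σ := σ)
  obtain _ | p := p
  · have hinj : Function.Injective F.aug := by
      rw [← LinearMap.ker_eq_bot, ← F.exact_zero, LinearMap.range_eq_bot]
      have : IsEmpty (Fin (F.rk (0 + 1))) := by
        rw [hz]
        infer_instance
      exact Subsingleton.elim _ _
    have : Nonempty (Fin (F.rk 0)) := ⟨⟨0, Nat.pos_of_ne_zero hp⟩⟩
    obtain rfl : e = Fintype.card σ := he
    exact (hself.pi (Fin (F.rk 0))).of_iso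
      (LinearEquiv.ofBijective F.aug ⟨hinj, F.aug_surj⟩).toModuleIso
  · obtain ⟨hv, f, hf, hb⟩ := hF.hasExtDepth_range hp hz p 0 (e + 1) (by omega) (by omega)
    obtain ⟨w, hS⟩ := F.shortExact_aug
    exact HasExtDepth.pred hS (fun m hm => hv m (by omega)) hf hb
      (fun m hm => (hself.1 m (by omega)).pi _)

end AuslanderBuchsbaum

section LocalCohomologyBridge

open CategoryTheory Limits

variable {R : Type} [CommRing R] {M : ModuleCat.{0} R}

variable (M) in
/-- The complex `Hom(P, M)`, as a chain complex in the opposite category. -/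
noncomputable abbrev opHomComplex (P : ChainComplex (ModuleCat.{0} R) ℕ) :
    ChainComplex (ModuleCat.{0} R)ᵒᵖ ℕ :=
  (((linearYoneda R (ModuleCat.{0} R)).obj M).rightOp.mapHomologicalComplex _).obj P

variable {P Q : ChainComplex (ModuleCat.{0} R) ℕ} {i : ℕ}

/-- The morphism `R ⟶ Hom(P.X i, M)` with `1 ↦ f`, in the opposite category. -/
noncomputable def cochainOp (f : P.X i ⟶ M) :
    (opHomComplex M P).X i ⟶ .op (ModuleCat.of R R) :=
  (ModuleCat.ofHom (LinearMap.toSpanSingleton R (P.X i ⟶ M) f)).op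

theorem d_comp_cochainOp (j : ℕ) (f : P.X i ⟶ M) :
    (opHomComplex M P).d j i ≫ cochainOp f = cochainOp (P.d j i ≫ f) := by
  refine Quiver.Hom.unop_inj (ModuleCat.hom_ext (LinearMap.ext_ring ?_))
  change P.d j i ≫ ((1 : R) • f) = (1 : R) • (P.d j i ≫ f)
  rw [one_smul, one_smul]

theorem f_comp_cochainOp (φ : P ⟶ Q) (f : Q.X i ⟶ M) :
    ((((linearYoneda R (ModuleCat.{0} R)).obj M).rightOp.mapHomologicalComplex _).map φ).f i ≫
      cochainOp f = cochainOp (φ.f i ≫ f) := by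
  refine Quiver.Hom.unop_inj (ModuleCat.hom_ext (LinearMap.ext_ring ?_))
  change φ.f i ≫ ((1 : R) • f) = (1 : R) • (φ.f i ≫ f)
  rw [one_smul, one_smul]

theorem cochainOp_zero : cochainOp (0 : P.X i ⟶ M) = 0 := by
  refine Quiver.Hom.unop_inj (ModuleCat.hom_ext (LinearMap.ext_ring ?_))
  change (1 : R) • (0 : P.X i ⟶ M) = 0
  rw [smul_zero]

/-- The cohomology class of a cocycle, in the opposite category. -/
noncomputable def cocycleClass {f : P.X i ⟶ M} (hf : IsCocycle P i f) :
    (opHomComplex M P).homology i ⟶ .op (ModuleCat.of R R) :=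
  (opHomComplex M P).homologyι i ≫ (opHomComplex M P).descOpcycles (cochainOp f) _ rfl
    (by rw [d_comp_cochainOp, hf, cochainOp_zero])

theorem isCoboundary_of_cocycleClass_eq_zero {f : P.X i ⟶ M} (hf : IsCocycle P i f)
    (h : cocycleClass hf = 0) : IsCoboundary P i f := by
  have hex := ShortComplex.exact_of_f_is_kernel
    (ShortComplex.mk _ _ ((opHomComplex M P).homologyι_comp_fromOpcycles i _))
    ((opHomComplex M P).homologyIsKernel i _ rfl)
  have : Projective (ModuleCat.of R R) :=
    ModuleCat.projective_of_free (Module.Basis.singleton Unit R)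
  have hg := hex.comp_descToInjective _ h
  set g := hex.descToInjective _ h
  have hg' : (opHomComplex M P).d i _ ≫ g = cochainOp f := by
    rw [← (opHomComplex M P).p_fromOpcycles, Category.assoc]
    exact (congrArg (_ ≫ ·) hg).trans ((opHomComplex M P).p_descOpcycles _ _ _ _)
  refine ⟨_, g.unop.hom (1 : R), ?_⟩
  have := congrArg (fun u => u.unop.hom (1 : R)) hg'
  exact this.trans (one_smul R f)

theorem homologyMap_comp_cocycleClass (φ : P ⟶ Q) {f : Q.X i ⟶ M} (hf : IsCocycle Q i f)
    (hf' : IsCocycle P i (φ.f i ≫ f)) :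
    HomologicalComplex.homologyMap
      ((((linearYoneda R (ModuleCat.{0} R)).obj M).rightOp.mapHomologicalComplex _).map φ) i ≫
      cocycleClass hf = cocycleClass hf' := by
  rw [cocycleClass, cocycleClass, HomologicalComplex.homologyι_naturality_assoc]
  congr 1
  rw [← cancel_epi ((opHomComplex M P).pOpcycles i), HomologicalComplex.p_opcyclesMap_assoc,
    HomologicalComplex.p_descOpcycles, HomologicalComplex.p_descOpcycles, f_comp_cochainOp]

theorem isZero_Ext_of_isCoboundary {X : ModuleCat.{0} R} (P : ProjectiveResolution X)
    (h : ∀ f : P.complex.X i ⟶ M, IsCocycle P.complex i f → IsCoboundary P.complex i f) :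
    IsZero (((Ext R (ModuleCat.{0} R) i).obj (.op X)).obj M) := by
  refine IsZero.of_iso ?_ (P.isoExt i M)
  rw [← HomologicalComplex.exactAt_iff_isZero_homology, HomologicalComplex.exactAt_iff,
    ShortComplex.moduleCat_exact_iff]
  intro f hf
  change P.complex.X i ⟶ M at f
  change P.complex.d ((ComplexShape.up ℕ).next i) i ≫ f = 0 at hf
  rw [CochainComplex.next] at hf
  obtain ⟨j, g, hg⟩ := h f (fun j => by
    by_cases hj : j = i + 1
    · rw [hj, hf]
    · rw [P.complex.shape j i (by simpa [eq_comm] using hj), zero_comp])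
  by_cases hj : j + 1 = i
  · obtain rfl : (ComplexShape.up ℕ).prev i = j := (ComplexShape.up ℕ).prev_eq' hj
    exact ⟨g, hg⟩
  · rw [P.complex.shape i j hj, zero_comp] at hg
    exact ⟨0, (map_zero _).trans hg⟩

/-- The class of a cocycle in `Ext`, as a morphism from `R`. -/
noncomputable def extClass {X : ModuleCat.{0} R} (P : ProjectiveResolution X)
    {f : P.complex.X i ⟶ M} (hf : IsCocycle P.complex i f) :
    ModuleCat.of R R ⟶ ((Ext R (ModuleCat.{0} R) i).obj (.op X)).obj M :=
  (cocycleClass hf).unop ≫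
    (P.isoLeftDerivedObj ((linearYoneda R (ModuleCat.{0} R)).obj M).rightOp i).unop.hom

theorem isCoboundary_of_extClass_eq_zero {X : ModuleCat.{0} R} (P : ProjectiveResolution X)
    {f : P.complex.X i ⟶ M} (hf : IsCocycle P.complex i f) (h : extClass P hf = 0) :
    IsCoboundary P.complex i f := by
  refine isCoboundary_of_cocycleClass_eq_zero hf (Quiver.Hom.unop_inj ?_)
  let u := (P.isoLeftDerivedObj ((linearYoneda R (ModuleCat.{0} R)).obj M).rightOp i).unop
  have h1 := congrArg ((cocycleClass hf).unop ≫ ·) u.hom_inv_id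
  have h2 := congrArg (· ≫ u.inv) h
  exact (Category.comp_id _).symm.trans
    (h1.symm.trans ((Category.assoc _ _ _).symm.trans (h2.trans zero_comp)))

theorem extClass_comp_map {X Y : ModuleCat.{0} R} (g : X ⟶ Y)
    (P : ProjectiveResolution X) (Q : ProjectiveResolution Y) (φ : P.complex ⟶ Q.complex)
    (comm : φ.f 0 ≫ Q.π.f 0 = P.π.f 0 ≫ g) {f : Q.complex.X i ⟶ M}
    (hf : IsCocycle Q.complex i f) (hf' : IsCocycle P.complex i (φ.f i ≫ f)) :
    extClass Q hf ≫ ((Ext R (ModuleCat.{0} R) i).map g.op).app M = extClass P hf' := by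
  have h1 := ProjectiveResolution.isoLeftDerivedObj_hom_naturality g P Q φ comm
    ((linearYoneda R (ModuleCat.{0} R)).obj M).rightOp i
  have h2 := homologyMap_comp_cocycleClass φ hf hf'
  have h3 := congrArg (fun u => (cocycleClass hf).unop ≫ u.unop) h1
  have h4 := congrArg (fun u => u.unop ≫ (P.isoLeftDerivedObj
    ((linearYoneda R (ModuleCat.{0} R)).obj M).rightOp i).hom.unop) h2
  exact (Category.assoc _ _ _).trans (h3.trans ((Category.assoc _ _ _).symm.trans h4))

variable {J : Ideal R} {e : ℕ}

theorem isZero_localCohomology_of_extVanishes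
    (h : ExtVanishes (fun n => (powRes J n).complex) i M) :
    Subsingleton ((localCohomology J i).obj M) := by
  let D := localCohomology.diagram (localCohomology.idealPowersDiagram J) i
  have hc := isColimitOfPreserves ((evaluation _ _).obj M) (colimit.isColimit D)
  refine subsingleton_of_forall_eq 0 fun x => ?_
  obtain ⟨j, y, rfl⟩ := Concrete.isColimit_exists_rep _ hc x
  let u : j ⟶ .op (.op (j.unop.unop + 1)) := (homOfLE (Nat.le_succ _)).op.op
  have hz : ∀ z : ((D ⋙ (evaluation _ _).obj M).obj (.op (.op (j.unop.unop + 1)))), z = 0 := by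
    have hz := isZero_Ext_of_isCoboundary (powRes J j.unop.unop) (h j.unop.unop)
    have := ModuleCat.subsingleton_of_isZero hz
    exact fun z => Subsingleton.elim (α := ((Ext R (ModuleCat.{0} R) i).obj (.op _)).obj M) _ _
  refine (Concrete.isColimit_rep_eq_iff_exists _ hc y (0 : (D ⋙ (evaluation _ _).obj M).obj j)).2
    ⟨_, u, u, (hz _).trans (hz _).symm⟩ |>.trans (map_zero _)

theorem nontrivial_localCohomology_of_isPersistentCocycle
    {f : (powRes J 0).complex.X i ⟶ M} (hf : IsPersistentCocycle (powTrans J) i f) :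
    Nontrivial ((localCohomology J i).obj M) := by
  obtain ⟨hf, hn⟩ := hf
  let D := localCohomology.diagram (localCohomology.idealPowersDiagram J) i
  have hc := isColimitOfPreserves ((evaluation _ _).obj M) (colimit.isColimit D)
  let y : (D ⋙ (evaluation _ _).obj M).obj (.op (.op (0 + 1))) :=
    (extClass (powRes J 0) hf).hom (1 : R)
  refine ⟨_, 0, fun h0 :
    (((evaluation _ _).obj M).mapCocone (colimit.cocone D)).ι.app _ y = 0 => ?_⟩
  obtain ⟨j, u, v, huv⟩ := (Concrete.isColimit_rep_eq_iff_exists _ hc y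
    (0 : (D ⋙ (evaluation _ _).obj M).obj (.op (.op (0 + 1))))).1 (h0.trans (map_zero _).symm)
  have hj : 0 + 1 ≤ j.unop.unop := leOfHom u.unop.unop
  obtain ⟨n, hn'⟩ : ∃ n, j = .op (.op (n + 1)) := ⟨j.unop.unop - 1, by
    rw [Nat.sub_add_cancel hj]⟩
  subst hn'
  have hf' : IsCocycle (powRes J n).complex i ((powTrans J n).f i ≫ f) := hf.chainMap _
  refine hn n (isCoboundary_of_extClass_eq_zero _ hf' ?_)
  have hmap := extClass_comp_map ((quotPow J).map (homOfLE (Nat.le_add_left (0 + 1) n)).op) _ _ _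
    (ProjectiveResolution.lift_commutes_zero _ _ _) hf hf'
  refine hmap.symm.trans (ModuleCat.hom_ext (LinearMap.ext_ring ?_))
  exact huv.trans (map_zero _)

theorem HasExtDepth.sInf_eq (h : HasExtDepth (powTrans J) e M) :
    sInf {i : ℕ | Nontrivial ((localCohomology J i).obj M)} = e := by
  obtain ⟨hv, f, hf⟩ := h
  have he : e ∈ {i : ℕ | Nontrivial ((localCohomology J i).obj M)} :=
    nontrivial_localCohomology_of_isPersistentCocycle hf
  refine le_antisymm (Nat.sInf_le he) (le_csInf ⟨_, he⟩ fun i hi => ?_)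
  by_contra! hlt
  have := isZero_localCohomology_of_extVanishes (hv i hlt)
  exact not_nontrivial_iff_subsingleton.2 this hi

end LocalCohomologyBridge

section TotalResolution

variable {k : Type} [Field k] {σ : Type} {M : Type} [AddCommGroup M] [Module (MvPolynomial σ k) M]
  {gr : ℤ → AddSubgroup M} {L : Type} {hd : L → ℕ} {tw : L → ℤ}

variable (k σ M gr) [DecidableEq L] in
/-- A finite graded free resolution, with all free modules collected in a single one whose basis
elements `l` carry a homological degree `hd l` and a twist `tw l`. -/
structure TotalRes (hd : L → ℕ) (tw : L → ℤ) where
  D : (L → MvPolynomial σ k) →ₗ[MvPolynomial σ k] (L → MvPolynomial σ k)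
  aug : (L → MvPolynomial σ k) →ₗ[MvPolynomial σ k] M
  D_hd : ∀ l l', D (Pi.single l 1) l' ≠ 0 → hd l = hd l' + 1
  aug_hd : ∀ l, hd l ≠ 0 → aug (Pi.single l 1) = 0
  D_homog : ∀ l l', homogZ k (D (Pi.single l 1) l') (tw l - tw l')
  aug_homog : ∀ l, aug (Pi.single l 1) ∈ gr (tw l)
  D_comp_D : ∀ z, D (D z) = 0
  aug_comp_D : ∀ z, aug (D z) = 0
  aug_surj : Function.Surjective aug
  exact : ∀ z, D z = 0 → aug z = 0 → ∃ w, D w = z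

/-- The part of homological degree `n`. -/
def degPart {R : Type} [CommRing R] (hd : L → ℕ) (n : ℕ) : (L → R) →ₗ[R] (L → R) where
  toFun z l := if hd l = n then z l else 0
  map_add' x y := by ext l; by_cases h : hd l = n <;> simp [h]
  map_smul' c x := by ext l; by_cases h : hd l = n <;> simp [h]

theorem degPart_apply {R : Type} [CommRing R] (n : ℕ) (z : L → R) (l : L) :
    degPart hd n z l = if hd l = n then z l else 0 := rfl

theorem degPart_single [DecidableEq L] {R : Type} [CommRing R] (n : ℕ) (l : L) (c : R) :
    degPart hd n (Pi.single l c) = if hd l = n then Pi.single l c else 0 := by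
  ext l'
  by_cases h : l' = l
  · subst h
    by_cases h' : hd l' = n <;> simp [degPart_apply, h']
  · by_cases h' : hd l = n <;> simp [degPart_apply, h, h']

theorem degPart_degPart {R : Type} [CommRing R] (n : ℕ) (z : L → R) :
    degPart hd n (degPart hd n z) = degPart hd n z := by
  ext l
  by_cases h : hd l = n <;> simp [degPart_apply, h]

theorem ext_degPart {R : Type} [CommRing R] (hd : L → ℕ) {z w : L → R}
    (h : ∀ n, degPart hd n z = degPart hd n w) : z = w := by
  ext l
  simpa [degPart_apply] using congrFun (h (hd l)) l

section

variable [Fintype L]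

/-- The basis elements of homological degree `n`. -/
noncomputable def degEquiv (hd : L → ℕ) (n : ℕ) :
    Fin (Fintype.card {l // hd l = n}) ≃ {l // hd l = n} :=
  (Fintype.equivFin _).symm

/-- The inclusion of the free module on the basis elements of homological degree `n`. -/
noncomputable def inclDeg (R : Type) [CommRing R] (hd : L → ℕ) (n : ℕ) :
    (Fin (Fintype.card {l // hd l = n}) → R) →ₗ[R] (L → R) where
  toFun z l := if h : hd l = n then z ((degEquiv hd n).symm ⟨l, h⟩) else 0
  map_add' x y := by ext l; by_cases h : hd l = n <;> simp [h]
  map_smul' c x := by ext l; by_cases h : hd l = n <;> simp [h]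

/-- The restriction to the basis elements of homological degree `n`. -/
noncomputable def restrDeg (R : Type) [CommRing R] (hd : L → ℕ) (n : ℕ) :
    (L → R) →ₗ[R] (Fin (Fintype.card {l // hd l = n}) → R) :=
  LinearMap.funLeft R R fun i => (degEquiv hd n i).1

theorem restrDeg_apply {R : Type} [CommRing R] (n : ℕ) (z : L → R)
    (i : Fin (Fintype.card {l // hd l = n})) :
    restrDeg R hd n z i = z (degEquiv hd n i).1 := rfl

theorem restrDeg_inclDeg {R : Type} [CommRing R] (n : ℕ)
    (z : Fin (Fintype.card {l // hd l = n}) → R) : restrDeg R hd n (inclDeg R hd n z) = z := by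
  ext i
  simp [restrDeg_apply, inclDeg, (degEquiv hd n i).2]

theorem inclDeg_restrDeg {R : Type} [CommRing R] (n : ℕ) (z : L → R) :
    inclDeg R hd n (restrDeg R hd n z) = degPart hd n z := by
  ext l
  by_cases h : hd l = n <;> simp [restrDeg_apply, inclDeg, degPart_apply, h]

theorem degPart_inclDeg {R : Type} [CommRing R] (n : ℕ)
    (z : Fin (Fintype.card {l // hd l = n}) → R) :
    degPart hd n (inclDeg R hd n z) = inclDeg R hd n z := by
  rw [← inclDeg_restrDeg, restrDeg_inclDeg]

theorem inclDeg_single [DecidableEq L] {R : Type} [CommRing R] (n : ℕ)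
    (i : Fin (Fintype.card {l // hd l = n})) :
    inclDeg R hd n (Pi.single i 1) = Pi.single (degEquiv hd n i).1 1 := by
  ext l
  by_cases h : hd l = n
  · simp [inclDeg, h, Pi.single_apply, Equiv.symm_apply_eq, Subtype.ext_iff]
  · have : l ≠ (degEquiv hd n i).1 := fun h' => h (h' ▸ (degEquiv hd n i).2)
    simp [inclDeg, h, this]

end

namespace TotalRes

variable [Fintype L] [DecidableEq L] (T : TotalRes k σ M gr hd tw)

theorem D_degPart_succ (n : ℕ) (z : L → MvPolynomial σ k) :
    T.D (degPart hd (n + 1) z) = degPart hd n (T.D z) := by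
  suffices T.D ∘ₗ degPart hd (n + 1) = degPart hd n ∘ₗ T.D from LinearMap.congr_fun this z
  refine (Pi.basisFun _ L).ext fun l => funext fun l' => ?_
  simp only [Pi.basisFun_apply, LinearMap.comp_apply, degPart_single, degPart_apply]
  by_cases h0 : T.D (Pi.single l 1) l' = 0
  · split_ifs <;> simp [h0]
  · have := T.D_hd l l' h0
    split_ifs <;> first | rfl | omega | simp

theorem D_degPart_zero (z : L → MvPolynomial σ k) : T.D (degPart hd 0 z) = 0 := by
  suffices T.D ∘ₗ degPart hd 0 = 0 from LinearMap.congr_fun this z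
  refine (Pi.basisFun _ L).ext fun l => funext fun l' => ?_
  simp only [Pi.basisFun_apply, LinearMap.comp_apply, degPart_single]
  by_cases h0 : T.D (Pi.single l 1) l' = 0
  · split_ifs <;> simp [h0]
  · have := T.D_hd l l' h0
    rw [if_neg (by omega)]
    simp

theorem aug_degPart_zero (z : L → MvPolynomial σ k) : T.aug (degPart hd 0 z) = T.aug z := by
  suffices T.aug ∘ₗ degPart hd 0 = T.aug from LinearMap.congr_fun this z
  refine (Pi.basisFun _ L).ext fun l => ?_
  simp only [Pi.basisFun_apply, LinearMap.comp_apply, degPart_single]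
  split_ifs with h
  · rfl
  · rw [map_zero, T.aug_hd l h]

theorem aug_degPart_succ (n : ℕ) (z : L → MvPolynomial σ k) :
    T.aug (degPart hd (n + 1) z) = 0 := by
  rw [← T.aug_degPart_zero]
  convert map_zero T.aug
  ext1 l
  simp only [degPart_apply, Pi.zero_apply]
  split_ifs <;> first | rfl | omega

/-- The resolution with its free modules separated by homological degree. -/
noncomputable def toGradedFreeRes : GradedFreeRes k σ M gr where
  rk n := Fintype.card {l // hd l = n}
  tw n i := tw (degEquiv hd n i).1
  bdd := by
    refine ⟨Finset.univ.sup hd + 1, fun i hi => Fintype.card_eq_zero_iff.2 ⟨fun l => ?_⟩⟩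
    have := Finset.le_sup (f := hd) (Finset.mem_univ l.1)
    have := l.2
    omega
  aug := T.aug ∘ₗ inclDeg _ hd 0
  d n := restrDeg _ hd n ∘ₗ T.D ∘ₗ inclDeg _ hd (n + 1)
  aug_surj m := by
    obtain ⟨z, rfl⟩ := T.aug_surj m
    refine ⟨restrDeg _ hd 0 z, ?_⟩
    rw [LinearMap.comp_apply, inclDeg_restrDeg, aug_degPart_zero]
  exact_zero := by
    ext z
    constructor
    · rintro ⟨w, rfl⟩
      simp only [LinearMap.mem_ker, LinearMap.comp_apply, inclDeg_restrDeg, aug_degPart_zero,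
        aug_comp_D]
    · intro hz
      obtain ⟨w, hw⟩ := T.exact (inclDeg _ hd 0 z) (by rw [← degPart_inclDeg, D_degPart_zero]) hz
      refine ⟨restrDeg _ hd 1 w, ?_⟩
      rw [LinearMap.comp_apply, LinearMap.comp_apply, inclDeg_restrDeg, D_degPart_succ, hw,
        degPart_inclDeg, restrDeg_inclDeg]
  exact_succ n := by
    ext z
    constructor
    · rintro ⟨w, rfl⟩
      simp only [LinearMap.mem_ker, LinearMap.comp_apply, inclDeg_restrDeg, D_degPart_succ,
        D_comp_D, map_zero]
    · intro hz
      have hz' : T.D (inclDeg _ hd (n + 1) z) = 0 := by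
        have := congrArg (inclDeg _ hd n) hz
        rwa [map_zero, LinearMap.comp_apply, LinearMap.comp_apply, inclDeg_restrDeg,
          ← D_degPart_succ, degPart_inclDeg] at this
      obtain ⟨w, hw⟩ := T.exact _ hz' (by rw [← degPart_inclDeg, aug_degPart_succ])
      refine ⟨restrDeg _ hd (n + 1 + 1) w, ?_⟩
      rw [LinearMap.comp_apply, LinearMap.comp_apply, inclDeg_restrDeg, D_degPart_succ, hw,
        degPart_inclDeg, restrDeg_inclDeg]
  aug_homog i := by
    rw [LinearMap.comp_apply, inclDeg_single]
    exact T.aug_homog _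
  d_homog n i i' := by
    rw [LinearMap.comp_apply, LinearMap.comp_apply, inclDeg_single]
    exact T.D_homog _ _

theorem toGradedFreeRes_isMinimal (hT : ∀ l l', constantCoeff (T.D (Pi.single l 1) l') = 0) :
    T.toGradedFreeRes.IsMinimal := fun n i i' =>
  (congrArg (fun z => constantCoeff (restrDeg _ hd n (T.D z) i'))
    (inclDeg_single (n + 1) i)).trans (hT _ _)

theorem exists_toGradedFreeRes_tw_eq (l : L) : ∃ i, T.toGradedFreeRes.tw (hd l) i = tw l :=
  ⟨(degEquiv hd (hd l)).symm ⟨l, rfl⟩, by simp [toGradedFreeRes]⟩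

theorem exists_of_toGradedFreeRes {n : ℕ} (i : Fin (T.toGradedFreeRes.rk n)) :
    ∃ l, hd l = n ∧ tw l = T.toGradedFreeRes.tw n i :=
  ⟨(degEquiv hd n i).1, (degEquiv hd n i).2, rfl⟩

end TotalRes

namespace GradedFreeRes

variable (F : GradedFreeRes k σ M gr)

theorem finite_sigma : Finite (Σ i, Fin (F.rk i)) := by
  obtain ⟨N, hN⟩ := F.bdd
  have hlt : ∀ x : Σ i, Fin (F.rk i), x.1 < N := fun x => by
    by_contra! hx
    have := x.2.pos
    have := hN _ hx
    omega
  exact Finite.of_injective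
    (fun x : Σ i, Fin (F.rk i) => (⟨⟨x.1, hlt x⟩, x.2⟩ : Σ i : Fin N, Fin (F.rk i)))
    fun x y h => by
      obtain ⟨i, x⟩ := x
      obtain ⟨j, y⟩ := y
      simp only [Sigma.mk.injEq, Fin.mk.injEq] at h
      obtain ⟨rfl, h⟩ := h
      rw [eq_of_heq h]

theorem single_sigma_same {i : ℕ} (l : Fin (F.rk i)) (c : MvPolynomial σ k) :
    (fun l' => (Pi.single ⟨i, l⟩ c : (Σ i, Fin (F.rk i)) → MvPolynomial σ k) ⟨i, l'⟩) =
      Pi.single l c := by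
  ext1 l'
  simp [Pi.single_apply]

theorem single_sigma_ne {i j : ℕ} (h : i ≠ j) (l : Fin (F.rk i)) (c : MvPolynomial σ k) :
    (fun l' => (Pi.single ⟨i, l⟩ c : (Σ i, Fin (F.rk i)) → MvPolynomial σ k) ⟨j, l'⟩) = 0 := by
  ext1 l'
  simp [h.symm]

/-- The differential of the total resolution. -/
noncomputable def totalD : ((Σ i, Fin (F.rk i)) → MvPolynomial σ k) →ₗ[MvPolynomial σ k]
    ((Σ i, Fin (F.rk i)) → MvPolynomial σ k) where
  toFun z x := F.d x.1 (fun l => z ⟨x.1 + 1, l⟩) x.2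
  map_add' z w := funext fun x => congrFun
    (map_add (F.d x.1) (fun l => z ⟨x.1 + 1, l⟩) (fun l => w ⟨x.1 + 1, l⟩)) x.2
  map_smul' c z := funext fun x => congrFun (map_smul (F.d x.1) c (fun l => z ⟨x.1 + 1, l⟩)) x.2

theorem totalD_single_ne {j : ℕ} (m : Fin (F.rk j)) {x : Σ i, Fin (F.rk i)} (h : j ≠ x.1 + 1) :
    F.totalD (Pi.single ⟨j, m⟩ 1) x = 0 := by
  change F.d x.1 (fun l => (Pi.single ⟨j, m⟩ 1 : (Σ i, Fin (F.rk i)) → MvPolynomial σ k)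
    ⟨x.1 + 1, l⟩) x.2 = 0
  rw [F.single_sigma_ne h, map_zero, Pi.zero_apply]

theorem totalD_single_succ {i : ℕ} (m : Fin (F.rk (i + 1))) (l : Fin (F.rk i)) :
    F.totalD (Pi.single ⟨i + 1, m⟩ 1) ⟨i, l⟩ = F.d i (Pi.single m 1) l := by
  change F.d i (fun l' => (Pi.single ⟨i + 1, m⟩ 1 : (Σ i, Fin (F.rk i)) → MvPolynomial σ k)
    ⟨i + 1, l'⟩) l = _
  rw [F.single_sigma_same]

theorem IsMinimal.constantCoeff_totalD {F : GradedFreeRes k σ M gr} (hF : F.IsMinimal)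
    [DecidableEq (Σ i, Fin (F.rk i))] (x y : Σ i, Fin (F.rk i)) :
    constantCoeff (F.totalD (Pi.single x 1) y) = 0 := by
  obtain ⟨j, m⟩ := x
  obtain ⟨i, l⟩ := y
  by_cases hj : j = i + 1
  · subst hj
    convert hF i m l
    convert F.totalD_single_succ m l
  · have h : F.totalD (Pi.single ⟨j, m⟩ 1) ⟨i, l⟩ = 0 := by
      convert F.totalD_single_ne m (x := ⟨i, l⟩) hj
    rw [h, map_zero]

/-- The total resolution of a graded free resolution. -/
noncomputable def toTotalRes [Fintype (Σ i, Fin (F.rk i))] :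
    TotalRes k σ M gr (fun x : Σ i, Fin (F.rk i) => x.1) (fun x => F.tw x.1 x.2) where
  D := F.totalD
  aug := F.aug ∘ₗ LinearMap.funLeft _ _ (fun l => ⟨0, l⟩)
  D_hd := by
    rintro ⟨j, m⟩ x h
    by_contra hj
    exact h (F.totalD_single_ne m hj)
  aug_hd := by
    rintro ⟨j, m⟩ h
    exact (congrArg F.aug (F.single_sigma_ne h m 1)).trans (map_zero _)
  D_homog := by
    rintro ⟨j, m⟩ ⟨i, l⟩
    by_cases hj : j = i + 1
    · subst hj
      rw [totalD_single_succ]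
      exact F.d_homog i m l
    · rw [F.totalD_single_ne m hj]
      exact Or.inl rfl
  aug_homog := by
    rintro ⟨j, m⟩
    obtain _ | j := j
    · rw [LinearMap.comp_apply]
      have h := F.aug_homog m
      rwa [← F.single_sigma_same m 1] at h
    · have := (congrArg F.aug (F.single_sigma_ne (Nat.succ_ne_zero j) m 1)).trans (map_zero _)
      exact this ▸ (gr _).zero_mem
  D_comp_D z := funext fun x => congrFun
    (F.d_comp_d x.1 (fun l => z ⟨x.1 + 1 + 1, l⟩)) x.2
  aug_comp_D z := F.aug_comp_d (fun l => z ⟨0 + 1, l⟩)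
  aug_surj m := by
    obtain ⟨z, rfl⟩ := F.aug_surj m
    refine ⟨fun x => if h : x.1 = 0 then z (h ▸ x.2) else 0, ?_⟩
    rfl
  exact z hz hz0 := by
    have h : ∀ i, ∃ w, F.d i w = fun l => z ⟨i, l⟩ := by
      rintro (_ | i)
      · rw [← LinearMap.mem_range, F.exact_zero]
        exact hz0
      · rw [← LinearMap.mem_range, F.exact_succ]
        exact funext fun l => congrFun hz ⟨i, l⟩
    choose w hw using h
    refine ⟨fun x => match x with
      | ⟨0, _⟩ => 0
      | ⟨i + 1, l⟩ => w i l, ?_⟩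
    exact funext fun x => congrFun (hw x.1) x.2

end GradedFreeRes

end TotalResolution

section Contraction

/-- The signs `(-1) ^ hd l`. -/
def signMap {R L : Type} [CommRing R] (hd : L → ℕ) : (L → R) →ₗ[R] (L → R) where
  toFun z l := (-1) ^ hd l * z l
  map_add' _ _ := funext fun _ => mul_add _ _ _
  map_smul' _ _ := funext fun _ => mul_left_comm _ _ _

theorem signMap_apply {R L : Type} [CommRing R] (hd : L → ℕ) (z : L → R) (l : L) :
    signMap hd z l = (-1) ^ hd l * z l := rfl

theorem degPart_signMap {R L : Type} [CommRing R] (hd : L → ℕ) (n : ℕ) (z : L → R) :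
    degPart hd n (signMap hd z) = (-1 : R) ^ n • degPart hd n z := by
  ext l
  by_cases h : hd l = n <;> simp [degPart_apply, signMap_apply, h]

theorem signMap_degPart {R L : Type} [CommRing R] (hd : L → ℕ) (n : ℕ) (z : L → R) :
    signMap hd (degPart hd n z) = (-1 : R) ^ n • degPart hd n z := by
  ext l
  by_cases h : hd l = n <;> simp [degPart_apply, signMap_apply, h]

theorem exists_linearMap_apply_apply_apply {k V : Type} [Field k] [AddCommGroup V] [Module k V]
    (f : V →ₗ[k] V) : ∃ g : V →ₗ[k] V, ∀ z, f (g (f z)) = f z := by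
  obtain ⟨g, hg⟩ := f.rangeRestrict.exists_rightInverse_of_surjective f.range_rangeRestrict
  obtain ⟨g', hg'⟩ := g.exists_extend
  refine ⟨g', fun z => ?_⟩
  have h1 : g' (f z) = g (f.rangeRestrict z) := LinearMap.congr_fun hg' (f.rangeRestrict z)
  have h2 := LinearMap.congr_fun hg (f.rangeRestrict z)
  rw [h1]
  exact congrArg Subtype.val h2

variable {k : Type} [Field k] {σ : Type} {M : Type} [AddCommGroup M] [Module (MvPolynomial σ k) M]
  {gr : ℤ → AddSubgroup M} {L : Type} [Fintype L] [DecidableEq L] {hd : L → ℕ} {tw : L → ℤ}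

namespace TotalRes

theorem signMap_D (T : TotalRes k σ M gr hd tw) (z : L → MvPolynomial σ k) :
    signMap hd (T.D z) = -T.D (signMap hd z) := by
  refine ext_degPart hd fun n => ?_
  rw [degPart_signMap, map_neg, ← D_degPart_succ, ← D_degPart_succ, degPart_signMap, map_smul,
    pow_succ]
  simp

theorem aug_signMap (T : TotalRes k σ M gr hd tw) (z : L → MvPolynomial σ k) :
    T.aug (signMap hd z) = T.aug z := by
  rw [← T.aug_degPart_zero, degPart_signMap, pow_zero, one_smul, aug_degPart_zero]

theorem exists_homotopy (T : TotalRes k σ M gr hd tw) :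
    ∃ g : (L → MvPolynomial σ k) →ₗ[k] (L → MvPolynomial σ k),
      (∀ z, T.D (g (T.D z)) = T.D z) ∧ (∀ z, signMap hd (g z) = -g (signMap hd z)) ∧
        ∀ z, T.aug (g z) = 0 := by
  obtain ⟨g, hg⟩ := exists_linearMap_apply_apply_apply (T.D.restrictScalars k)
  simp only [LinearMap.coe_restrictScalars] at hg
  let g' : (L → MvPolynomial σ k) →ₗ[k] (L → MvPolynomial σ k) :=
    { toFun := fun z l => if hd l = 0 then 0 else g (degPart hd (hd l - 1) z) l
      map_add' := fun x y => by
        ext1 l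
        by_cases h : hd l = 0 <;> simp [h]
      map_smul' := fun c x => by
        ext1 l
        by_cases h : hd l = 0
        · simp [h]
        · have : degPart hd (hd l - 1) (c • x) = c • degPart hd (hd l - 1) x :=
            ((degPart hd (hd l - 1)).restrictScalars k).map_smul c x
          simp [h, this] }
  have hg' : ∀ n z, degPart hd (n + 1) (g' z) = degPart hd (n + 1) (g (degPart hd n z)) := by
    intro n z
    ext1 l
    by_cases h : hd l = n + 1 <;> simp [degPart_apply, h, g']
  have hg0 : ∀ z, degPart hd 0 (g' z) = 0 := by
    intro z
    ext1 l
    by_cases h : hd l = 0 <;> simp [degPart_apply, h, g']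
  refine ⟨g', fun z => ext_degPart hd fun n => ?_, fun z => ext_degPart hd fun n => ?_, fun z => ?_⟩
  · rw [← D_degPart_succ, hg', ← T.D_degPart_succ n z, D_degPart_succ, hg, D_degPart_succ,
      degPart_degPart]
  · rw [degPart_signMap, map_neg]
    obtain _ | n := n
    · simp [hg0]
    · have hs : ∀ w : L → MvPolynomial σ k, g ((-1 : MvPolynomial σ k) ^ n • w) =
          (-1 : MvPolynomial σ k) ^ n • g w := fun w => by
        rcases neg_one_pow_eq_or (MvPolynomial σ k) n with h | h <;> simp [h]
      rw [hg', hg', degPart_signMap, hs, map_smul, pow_succ]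
      simp
  · rw [← T.aug_degPart_zero, hg0, map_zero]

variable [Module k M] [IsScalarTower k (MvPolynomial σ k) M]

theorem exists_contraction (T : TotalRes k σ M gr hd tw) :
    ∃ (s : (L → MvPolynomial σ k) →ₗ[k] (L → MvPolynomial σ k))
      (u : M →ₗ[k] (L → MvPolynomial σ k)),
      (∀ z, T.D (s z) + s (T.D z) = z - u (T.aug z)) ∧
        (∀ z, signMap hd (s z) = -s (signMap hd z)) ∧
          (∀ m, signMap hd (u m) = u m) ∧ ∀ m, T.D (u m) = 0 := by
  obtain ⟨g, hDg, hSg, hag⟩ := T.exists_homotopy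
  obtain ⟨v, hv⟩ := (T.aug.restrictScalars k).exists_rightInverse_of_surjective
    (LinearMap.range_eq_top.2 T.aug_surj)
  replace hv : ∀ m, T.aug (v m) = m := LinearMap.congr_fun hv
  let w : M →ₗ[k] (L → MvPolynomial σ k) := (degPart hd 0).restrictScalars k ∘ₗ v
  have hw : ∀ m, w m = degPart hd 0 (v m) := fun _ => rfl
  let D := T.D.restrictScalars k
  have hSw : ∀ m, signMap hd (w m) = w m := fun m => by
    rw [hw, signMap_degPart, pow_zero, one_smul]
  refine ⟨g - g ∘ₗ g ∘ₗ D, w - D ∘ₗ g ∘ₗ w, fun z => ?_, fun z => ?_, fun m => ?_, fun m => ?_⟩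
  · obtain ⟨y, hy⟩ := T.exact (z - g (T.D z) - w (T.aug z))
      (by rw [map_sub, map_sub, hDg, hw, D_degPart_zero, sub_self, sub_zero])
      (by rw [map_sub, map_sub, hag, hw, aug_degPart_zero, hv, sub_zero, sub_self])
    have h := hDg y
    rw [hy] at h
    simp only [map_sub] at h
    simp only [LinearMap.sub_apply, LinearMap.comp_apply, LinearMap.coe_restrictScalars, D,
      map_sub, T.D_comp_D, map_zero, sub_zero]
    linear_combination (norm := module) h
  · simp only [LinearMap.sub_apply, LinearMap.comp_apply, LinearMap.coe_restrictScalars, D,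
      map_sub, hSg, signMap_D, map_neg]
    abel
  · simp only [LinearMap.sub_apply, LinearMap.comp_apply, LinearMap.coe_restrictScalars, D,
      map_sub, hSg, signMap_D, map_neg, hSw, neg_neg]
  · simp only [LinearMap.sub_apply, LinearMap.comp_apply, LinearMap.coe_restrictScalars, D,
      map_sub, T.D_comp_D, hw, D_degPart_zero, sub_zero]

end TotalRes

open TensorProduct

/-- The differential of the tensor product of two complexes, where `S` multiplies by the sign of the
homological degree. -/
def tensorDifferential {k C C' : Type} [Field k] [AddCommGroup C] [AddCommGroup C']
    [Module k C] [Module k C'] (D S : C →ₗ[k] C) (D' : C' →ₗ[k] C') :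
    C ⊗[k] C' →ₗ[k] C ⊗[k] C' :=
  D.rTensor C' + TensorProduct.map S D'

theorem tensorDifferential_tmul {k C C' : Type} [Field k] [AddCommGroup C] [AddCommGroup C']
    [Module k C] [Module k C'] (D S : C →ₗ[k] C) (D' : C' →ₗ[k] C') (x : C) (y : C') :
    tensorDifferential D S D' (x ⊗ₜ y) = D x ⊗ₜ y + S x ⊗ₜ D' y := rfl

/-- The tensor product of two augmented complexes with contractions is exact. -/
theorem exists_tensorDifferential_eq {k C C' M M' : Type} [Field k]
    [AddCommGroup C] [AddCommGroup C'] [AddCommGroup M] [AddCommGroup M']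
    [Module k C] [Module k C'] [Module k M] [Module k M']
    (D S s : C →ₗ[k] C) (D' s' : C' →ₗ[k] C') (ε : C →ₗ[k] M) (ε' : C' →ₗ[k] M')
    (u : M →ₗ[k] C) (u' : M' →ₗ[k] C')
    (hs : ∀ z, D (s z) + s (D z) = z - u (ε z)) (hs' : ∀ z, D' (s' z) + s' (D' z) = z - u' (ε' z))
    (hSs : ∀ z, S (s z) = -s (S z)) (hSu : ∀ m, S (u m) = u m) (hDu : ∀ m, D (u m) = 0)
    (hεD : ∀ z, ε (D z) = 0) (hεS : ∀ z, ε (S z) = ε z)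
    (z : C ⊗[k] C') (hz : tensorDifferential D S D' z = 0) (hεz : TensorProduct.map ε ε' z = 0) :
    ∃ w, tensorDifferential D S D' w = z := by
  let h : C ⊗[k] C' →ₗ[k] C ⊗[k] C' := s.rTensor C' + TensorProduct.map (u ∘ₗ ε) s'
  have htmul : ∀ x y, h (x ⊗ₜ y) = s x ⊗ₜ y + u (ε x) ⊗ₜ s' y := fun _ _ => rfl
  have key : tensorDifferential D S D' ∘ₗ h + h ∘ₗ tensorDifferential D S D' +
      TensorProduct.map u u' ∘ₗ TensorProduct.map ε ε' = LinearMap.id := by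
    refine TensorProduct.ext' fun x y => ?_
    simp only [LinearMap.add_apply, LinearMap.comp_apply, TensorProduct.map_tmul, map_add,
      LinearMap.id_apply, htmul, tensorDifferential_tmul, hDu, hSs, hSu, hεD, hεS, map_zero,
      zero_tmul, neg_tmul]
    have h1 := congrArg (· ⊗ₜ[k] y) (hs x)
    have h2 := congrArg (u (ε x) ⊗ₜ[k] ·) (hs' y)
    simp only [add_tmul, tmul_add, sub_tmul, tmul_sub] at h1 h2
    linear_combination (norm := module) h1 + h2
  refine ⟨h z, ?_⟩
  have := LinearMap.congr_fun key z
  simpa only [LinearMap.add_apply, LinearMap.comp_apply, hz, hεz, map_zero, add_zero,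
    LinearMap.id_apply] using this

end Contraction

section TensorResolution

open TensorProduct

variable {k : Type} [Field k] {σ τ : Type}

section Free

variable {L L' : Type}

/-- The comparison map from the tensor product of free modules over two polynomial rings to the free
module over the polynomial ring in both sets of variables. -/
noncomputable def freeTensorMap (k σ τ L L' : Type) [Field k] :
    (L → MvPolynomial σ k) ⊗[k] (L' → MvPolynomial τ k) →ₗ[k]
      (L × L' → MvPolynomial (σ ⊕ τ) k) :=
  TensorProduct.lift <| LinearMap.mk₂ k
    (fun f g p => rename Sum.inl (f p.1) * rename Sum.inr (g p.2))
    (fun f f' g => funext fun p => by simp [add_mul])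
    (fun c f g => funext fun p => by simp)
    (fun f g g' => funext fun p => by simp [mul_add])
    (fun c f g => funext fun p => by simp)

theorem freeTensorMap_tmul (f : L → MvPolynomial σ k) (g : L' → MvPolynomial τ k) (p : L × L') :
    freeTensorMap k σ τ L L' (f ⊗ₜ g) p = rename Sum.inl (f p.1) * rename Sum.inr (g p.2) := rfl

theorem freeTensorMap_single [DecidableEq L] [DecidableEq L'] (a : L) (b : L')
    (p : MvPolynomial σ k) (q : MvPolynomial τ k) :
    freeTensorMap k σ τ L L' (Pi.single a p ⊗ₜ Pi.single b q) =
      Pi.single (a, b) (rename Sum.inl p * rename Sum.inr q) := by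
  ext1 ⟨a', b'⟩
  rw [freeTensorMap_tmul]
  by_cases ha : a' = a <;> by_cases hb : b' = b <;> simp [ha, hb]

theorem freeTensorMap_bijective [Finite L] [Finite L'] :
    Function.Bijective (freeTensorMap k σ τ L L') := by
  classical
  have := Fintype.ofFinite L
  have := Fintype.ofFinite L'
  let b₁ := Pi.basis fun _ : L => basisMonomials σ k
  let b₂ := Pi.basis fun _ : L' => basisMonomials τ k
  let b₃ := Pi.basis fun _ : L × L' => basisMonomials (σ ⊕ τ) k
  let i : ((Σ _ : L, σ →₀ ℕ) × (Σ _ : L', τ →₀ ℕ)) ≃ (Σ _ : L × L', (σ ⊕ τ) →₀ ℕ) :=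
    { toFun := fun x => ⟨(x.1.1, x.2.1), x.1.2.sumElim x.2.2⟩
      invFun := fun y => (⟨y.1.1, (Finsupp.sumFinsuppEquivProdFinsupp y.2).1⟩,
        ⟨y.1.2, (Finsupp.sumFinsuppEquivProdFinsupp y.2).2⟩)
      left_inv := fun x => by
        have h := Finsupp.sumFinsuppEquivProdFinsupp.apply_symm_apply (x.1.2, x.2.2)
        ext1 <;> ext1
        · rfl
        · exact heq_of_eq (congrArg Prod.fst h)
        · rfl
        · exact heq_of_eq (congrArg Prod.snd h)
      right_inv := fun y => by
        ext1
        · rfl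
        · exact heq_of_eq (Finsupp.sumFinsuppEquivProdFinsupp.symm_apply_apply y.2) }
  suffices freeTensorMap k σ τ L L' = ((b₁.tensorProduct b₂).equiv b₃ i).toLinearMap by
    rw [this]
    exact ((b₁.tensorProduct b₂).equiv b₃ i).bijective
  refine (b₁.tensorProduct b₂).ext fun x => ?_
  rw [LinearEquiv.coe_coe, Module.Basis.equiv_apply, Module.Basis.tensorProduct_apply']
  simp only [b₁, b₂, b₃, i, Pi.basis_apply, freeTensorMap_single, coe_basisMonomials,
    rename_monomial, monomial_mul, mul_one, Finsupp.sumElim_eq_add, Equiv.coe_fn_mk]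

end Free

theorem homogZ.rename {p : MvPolynomial σ k} {e : ℤ} (hp : homogZ k p e) (f : σ → τ) :
    homogZ k (MvPolynomial.rename f p) e := by
  obtain rfl | ⟨he, hp⟩ := hp
  · exact Or.inl (map_zero _)
  · exact Or.inr ⟨he, hp.rename_isHomogeneous⟩

namespace TotalRes

variable {M N : Type} [AddCommGroup M] [Module (MvPolynomial σ k) M] [AddCommGroup N]
  [Module (MvPolynomial τ k) N] {grM : ℤ → AddSubgroup M} {grN : ℤ → AddSubgroup N}
  {L L' : Type} [Fintype L] [Fintype L'] [DecidableEq L] [DecidableEq L']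
  {hd : L → ℕ} {hd' : L' → ℕ} {tw : L → ℤ} {tw' : L' → ℤ}
  (T : TotalRes k σ M grM hd tw) (T' : TotalRes k τ N grN hd' tw')

/-- The differential of the tensor product of two total resolutions. -/
noncomputable def tensorD : (L × L' → MvPolynomial (σ ⊕ τ) k) →ₗ[MvPolynomial (σ ⊕ τ) k]
    (L × L' → MvPolynomial (σ ⊕ τ) k) where
  toFun z p := ∑ a, z (a, p.2) * rename Sum.inl (T.D (Pi.single a 1) p.1) +
    (-1) ^ hd p.1 * ∑ b, z (p.1, b) * rename Sum.inr (T'.D (Pi.single b 1) p.2)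
  map_add' z w := by
    ext1 p
    simp only [Pi.add_apply, add_mul, Finset.sum_add_distrib, mul_add]
    ring
  map_smul' c z := by
    ext1 p
    simp only [Pi.smul_apply, smul_eq_mul, RingHom.id_apply, mul_add, Finset.mul_sum]
    congr 1 <;> refine Finset.sum_congr rfl fun _ _ => by ring

theorem tensorD_apply (z : L × L' → MvPolynomial (σ ⊕ τ) k) (p : L × L') :
    T.tensorD T' z p = ∑ a, z (a, p.2) * rename Sum.inl (T.D (Pi.single a 1) p.1) +
      (-1) ^ hd p.1 * ∑ b, z (p.1, b) * rename Sum.inr (T'.D (Pi.single b 1) p.2) := rfl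

theorem tensorD_single (p q : L × L') :
    T.tensorD T' (Pi.single p 1) q =
      (if q.2 = p.2 then rename Sum.inl (T.D (Pi.single p.1 1) q.1) else 0) +
      (-1) ^ hd q.1 * (if q.1 = p.1 then rename Sum.inr (T'.D (Pi.single p.2 1) q.2) else 0) := by
  rw [tensorD_apply]
  congr 2
  · rw [Finset.sum_eq_single p.1]
    · simp [Pi.single_apply, Prod.ext_iff]
    · intro a _ ha
      simp [Prod.ext_iff, ha]
    · simp
  · rw [Finset.sum_eq_single p.2]
    · simp [Pi.single_apply, Prod.ext_iff]
    · intro b _ hb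
      simp [Prod.ext_iff, hb]
    · simp

theorem constantCoeff_tensorD (h : ∀ l l', constantCoeff (T.D (Pi.single l 1) l') = 0)
    (h' : ∀ l l', constantCoeff (T'.D (Pi.single l 1) l') = 0) (p q : L × L') :
    constantCoeff (T.tensorD T' (Pi.single p 1) q) = 0 := by
  rw [tensorD_single]
  split_ifs <;> simp [h, h', constantCoeff_rename]

theorem tensorD_freeTensorMap (x) :
    T.tensorD T' (freeTensorMap k σ τ L L' x) = freeTensorMap k σ τ L L'
      (tensorDifferential (T.D.restrictScalars k) ((signMap hd).restrictScalars k)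
        (T'.D.restrictScalars k) x) := by
  induction x using TensorProduct.induction_on with
  | zero => simp
  | add x y hx hy => simp only [map_add, hx, hy]
  | tmul f g =>
    ext1 p
    simp only [tensorDifferential_tmul, map_add, Pi.add_apply, tensorD_apply, freeTensorMap_tmul,
      LinearMap.coe_restrictScalars, signMap_apply, map_mul, map_pow, map_neg, map_one]
    rw [linearMap_apply_eq_sum T.D f, linearMap_apply_eq_sum T'.D g]
    simp only [Finset.sum_apply, Pi.smul_apply, smul_eq_mul, map_sum, map_mul, Finset.sum_mul,
      Finset.mul_sum]
    congr 1 <;> refine Finset.sum_congr rfl fun _ _ => by ring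

theorem tensorDifferential_tensorDifferential (x) :
    tensorDifferential (T.D.restrictScalars k) ((signMap hd).restrictScalars k)
      (T'.D.restrictScalars k)
      (tensorDifferential (T.D.restrictScalars k) ((signMap hd).restrictScalars k)
        (T'.D.restrictScalars k) x) = 0 := by
  induction x using TensorProduct.induction_on with
  | zero => simp
  | add x y hx hy => simp only [map_add, hx, hy, add_zero]
  | tmul f g =>
    simp only [tensorDifferential_tmul, map_add, LinearMap.coe_restrictScalars, T.D_comp_D,
      T'.D_comp_D, signMap_D, zero_tmul, tmul_zero, neg_tmul]
    abel

variable [Module k M] [IsScalarTower k (MvPolynomial σ k) M] [Module k N]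
  [IsScalarTower k (MvPolynomial τ k) N]

theorem map_aug_tensorDifferential (x) :
    TensorProduct.map (T.aug.restrictScalars k) (T'.aug.restrictScalars k)
      (tensorDifferential (T.D.restrictScalars k) ((signMap hd).restrictScalars k)
        (T'.D.restrictScalars k) x) = 0 := by
  induction x using TensorProduct.induction_on with
  | zero => simp
  | add x y hx hy => simp only [map_add, hx, hy, add_zero]
  | tmul f g =>
    simp [tensorDifferential_tmul, T.aug_comp_D, T'.aug_comp_D]

variable [Module (MvPolynomial (σ ⊕ τ) k) (M ⊗[k] N)]

/-- The augmentation of the tensor product of two total resolutions. -/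
noncomputable def tensorAug :
    (L × L' → MvPolynomial (σ ⊕ τ) k) →ₗ[MvPolynomial (σ ⊕ τ) k] M ⊗[k] N :=
  (Pi.basisFun _ (L × L')).constr (MvPolynomial (σ ⊕ τ) k)
    fun p => T.aug (Pi.single p.1 1) ⊗ₜ[k] T'.aug (Pi.single p.2 1)

theorem tensorAug_single (p : L × L') :
    T.tensorAug T' (Pi.single p 1) = T.aug (Pi.single p.1 1) ⊗ₜ[k] T'.aug (Pi.single p.2 1) := by
  rw [← Pi.basisFun_apply, tensorAug, Module.Basis.constr_basis]

theorem tensorAug_freeTensorMap (hsm : ∀ (a : MvPolynomial σ k) (b : MvPolynomial τ k) (m : M)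
    (n : N), (rename Sum.inl a * rename Sum.inr b : MvPolynomial (σ ⊕ τ) k) • (m ⊗ₜ[k] n) =
      (a • m) ⊗ₜ (b • n)) (x) :
    T.tensorAug T' (freeTensorMap k σ τ L L' x) =
      TensorProduct.map (T.aug.restrictScalars k) (T'.aug.restrictScalars k) x := by
  induction x using TensorProduct.induction_on with
  | zero => simp
  | add x y hx hy => simp only [map_add, hx, hy]
  | tmul f g =>
    rw [TensorProduct.map_tmul, LinearMap.coe_restrictScalars, LinearMap.coe_restrictScalars,
      linearMap_apply_eq_sum T.aug f, linearMap_apply_eq_sum T'.aug g,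
      linearMap_apply_eq_sum (T.tensorAug T'), TensorProduct.sum_tmul, Fintype.sum_prod_type]
    refine Finset.sum_congr rfl fun a _ => ?_
    rw [TensorProduct.tmul_sum]
    refine Finset.sum_congr rfl fun b _ => ?_
    rw [tensorAug_single, freeTensorMap_tmul, hsm]

/-- The tensor product of two total resolutions. -/
noncomputable def tensor (hsm : ∀ (a : MvPolynomial σ k) (b : MvPolynomial τ k) (m : M)
    (n : N), (rename Sum.inl a * rename Sum.inr b : MvPolynomial (σ ⊕ τ) k) • (m ⊗ₜ[k] n) =
      (a • m) ⊗ₜ (b • n)) :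
    TotalRes k (σ ⊕ τ) (M ⊗[k] N) (tensGr k M N grM grN)
      (fun p : L × L' => hd p.1 + hd' p.2) (fun p => tw p.1 + tw' p.2) where
  D := T.tensorD T'
  aug := T.tensorAug T'
  D_hd p q h := by
    contrapose! h
    rw [tensorD_single]
    have h1 : q.2 = p.2 → T.D (Pi.single p.1 1) q.1 = 0 := fun hq => by
      by_contra h0
      have := T.D_hd _ _ h0
      rw [hq] at h
      omega
    have h2 : q.1 = p.1 → T'.D (Pi.single p.2 1) q.2 = 0 := fun hq => by
      by_contra h0
      have := T'.D_hd _ _ h0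
      rw [hq] at h
      omega
    split_ifs with hq hq' hq' <;> simp_all
  aug_hd p h := by
    rw [tensorAug_single]
    by_cases h1 : hd p.1 = 0
    · rw [T'.aug_hd p.2 (by omega), tmul_zero]
    · rw [T.aug_hd p.1 h1, zero_tmul]
  D_homog p q := by
    rw [tensorD_single]
    refine homogZ.add ?_ ?_
    · split_ifs with hq
      · rw [hq, add_sub_add_right_eq_sub]
        exact (T.D_homog _ _).rename _
      · exact homogZ_zero _
    · split_ifs with hq
      · rw [hq, add_sub_add_left_eq_sub]
        rcases neg_one_pow_eq_or (MvPolynomial (σ ⊕ τ) k) (hd p.1) with h | h <;> rw [h]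
        · rw [one_mul]
          exact (T'.D_homog _ _).rename _
        · rw [neg_one_mul]
          exact ((T'.D_homog _ _).rename _).neg
      · rw [mul_zero]
        exact homogZ_zero _
  aug_homog p := by
    rw [tensorAug_single]
    exact AddSubgroup.subset_closure ⟨_, _, _, _, rfl, T.aug_homog _, T'.aug_homog _, rfl⟩
  D_comp_D z := by
    obtain ⟨x, rfl⟩ := freeTensorMap_bijective.2 z
    rw [tensorD_freeTensorMap, tensorD_freeTensorMap, tensorDifferential_tensorDifferential,
      map_zero]
  aug_comp_D z := by
    obtain ⟨x, rfl⟩ := freeTensorMap_bijective.2 z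
    rw [tensorD_freeTensorMap, tensorAug_freeTensorMap T T' hsm, map_aug_tensorDifferential]
  aug_surj x := by
    obtain ⟨y, rfl⟩ := TensorProduct.map_surjective (g := T.aug.restrictScalars k)
      (g' := T'.aug.restrictScalars k) T.aug_surj T'.aug_surj x
    exact ⟨_, tensorAug_freeTensorMap T T' hsm y⟩
  exact z hz hz0 := by
    obtain ⟨x, rfl⟩ := freeTensorMap_bijective.2 z
    rw [tensorAug_freeTensorMap T T' hsm] at hz0
    rw [tensorD_freeTensorMap] at hz
    replace hz := freeTensorMap_bijective.1 (hz.trans (map_zero _).symm)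
    obtain ⟨s, u, hs, hSs, hSu, hDu⟩ := T.exists_contraction
    obtain ⟨s', u', hs', -⟩ := T'.exists_contraction
    obtain ⟨w, hw⟩ := exists_tensorDifferential_eq (T.D.restrictScalars k)
      ((signMap hd).restrictScalars k) s (T'.D.restrictScalars k) s' (T.aug.restrictScalars k)
      (T'.aug.restrictScalars k) u u' hs hs' hSs hSu hDu T.aug_comp_D T.aug_signMap x hz hz0
    exact ⟨freeTensorMap k σ τ L L' w, by rw [tensorD_freeTensorMap, hw]⟩

end TotalRes

end TensorResolution

section TensorGrading

open TensorProduct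

variable {k : Type} [Field k] {σ τ : Type}
  {M : Type} [AddCommGroup M] [Module (MvPolynomial σ k) M] [Module k M]
  [IsScalarTower k (MvPolynomial σ k) M] {grM : ℤ → AddSubgroup M}

namespace GradedDecomp

theorem constant_smul_mem (G : GradedDecomp k σ grM) (c : k) {t : ℤ} {m : M} (hm : m ∈ grM t) :
    c • m ∈ grM t := by
  have h := G.smul_mem (isHomogeneous_C σ c) hm
  rwa [← algebraMap_eq, algebraMap_smul, Nat.cast_zero, add_zero] at h

theorem proj_constant_smul (G : GradedDecomp k σ grM) (c : k) (t : ℤ) (m : M) :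
    G.proj t (c • m) = c • G.proj t m := by
  induction G.span m using AddSubgroup.closure_induction with
  | mem x hx =>
    obtain ⟨t', ht'⟩ := hx
    rcases eq_or_ne t' t with rfl | h
    · rw [G.proj_same ht', G.proj_same (G.constant_smul_mem c ht')]
    · rw [G.proj_ne ht' h, G.proj_ne (G.constant_smul_mem c ht') h, smul_zero]
  | zero => simp
  | add x y _ _ hx hy => rw [smul_add, map_add, hx, hy, map_add, smul_add]
  | neg x _ hx => rw [smul_neg, map_neg, hx, map_neg, smul_neg]

theorem finite_support_proj (G : GradedDecomp k σ grM) (m : M) :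
    (Function.support fun t => G.proj t m).Finite := by
  induction G.span m using AddSubgroup.closure_induction with
  | mem x hx =>
    obtain ⟨t', ht'⟩ := hx
    refine (Set.finite_singleton t').subset fun t ht => ?_
    by_contra h
    exact ht (G.proj_ne ht' (Ne.symm h))
  | zero => simp
  | add x y _ _ hx hy =>
    simp only [map_add]
    exact (hx.union hy).subset (Function.support_add _ _)
  | neg x _ hx => simpa only [map_neg, Function.support_fun_neg] using hx

/-- The map sending an element to the family of its graded components. -/
noncomputable def components (G : GradedDecomp k σ grM) : M →ₗ[k] (ℤ →₀ M) where
  toFun m := Finsupp.ofSupportFinite (fun t => G.proj t m) (G.finite_support_proj m)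
  map_add' x y := Finsupp.ext fun t => by simp [Finsupp.ofSupportFinite_coe]
  map_smul' c x := Finsupp.ext fun t => by
    simp [Finsupp.ofSupportFinite_coe, G.proj_constant_smul]

theorem components_of_mem (G : GradedDecomp k σ grM) {t : ℤ} {m : M} (hm : m ∈ grM t) :
    G.components m = Finsupp.single t m := by
  ext t'
  simp only [components, LinearMap.coe_mk, AddHom.coe_mk, Finsupp.ofSupportFinite_coe]
  rcases eq_or_ne t t' with rfl | h
  · rw [G.proj_same hm, Finsupp.single_eq_same]
  · rw [G.proj_ne hm h, Finsupp.single_eq_of_ne' h]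

variable {N : Type} [AddCommGroup N] [Module (MvPolynomial τ k) N] [Module k N]
  [IsScalarTower k (MvPolynomial τ k) N] {grN : ℤ → AddSubgroup N}

/-- The map sending an element of the tensor product of two graded modules to the family of its
graded components. -/
noncomputable def tensorComponents (G : GradedDecomp k σ grM) (H : GradedDecomp k τ grN) :
    M ⊗[k] N →ₗ[k] (ℤ →₀ M ⊗[k] N) :=
  Finsupp.lmapDomain _ _ (fun p : ℤ × ℤ => p.1 + p.2) ∘ₗ
    (finsuppTensorFinsupp k k M N ℤ ℤ).toLinearMap ∘ₗ TensorProduct.map G.components H.components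

theorem tensorComponents_of_mem (G : GradedDecomp k σ grM) (H : GradedDecomp k τ grN) {t : ℤ}
    {x : M ⊗[k] N} (hx : x ∈ tensGr k M N grM grN t) :
    G.tensorComponents H x = Finsupp.single t x := by
  induction hx using AddSubgroup.closure_induction with
  | mem x hx =>
    obtain ⟨a, b, m, n, rfl, hm, hn, rfl⟩ := hx
    simp only [tensorComponents, LinearMap.comp_apply, TensorProduct.map_tmul,
      G.components_of_mem hm, H.components_of_mem hn, LinearEquiv.coe_coe,
      finsuppTensorFinsupp_single, Finsupp.lmapDomain_apply, Finsupp.mapDomain_single]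
  | zero => simp
  | add x y _ _ hx hy => rw [map_add, hx, hy, Finsupp.single_add]
  | neg x _ hx => rw [map_neg, hx, Finsupp.single_neg]

theorem smul_mem_tensGr [Module (MvPolynomial (σ ⊕ τ) k) (M ⊗[k] N)]
    (hsm : ∀ (a : MvPolynomial σ k) (b : MvPolynomial τ k) (m : M)
      (n : N), (rename Sum.inl a * rename Sum.inr b : MvPolynomial (σ ⊕ τ) k) • (m ⊗ₜ[k] n) =
        (a • m) ⊗ₜ (b • n))
    (G : GradedDecomp k σ grM) (H : GradedDecomp k τ grN) {p : MvPolynomial (σ ⊕ τ) k} {d : ℕ}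
    (hp : p.IsHomogeneous d) {t : ℤ} {x : M ⊗[k] N} (hx : x ∈ tensGr k M N grM grN t) :
    p • x ∈ tensGr k M N grM grN (t + d) := by
  induction hx using AddSubgroup.closure_induction with
  | mem x hx =>
    obtain ⟨a, b, m, n, rfl, hm, hn, rfl⟩ := hx
    rw [← p.support_sum_monomial_coeff, Finset.sum_smul]
    refine sum_mem fun v hv => ?_
    have hdeg : v.degree = d := by
      rw [Finsupp.degree_eq_weight_one]
      exact hp (mem_support_iff.1 hv)
    obtain ⟨⟨v₁, v₂⟩, hw⟩ := Finsupp.sumFinsuppEquivProdFinsupp.symm.surjective v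
    replace hw : v = v₁.mapDomain Sum.inl + v₂.mapDomain Sum.inr := by
      rw [← Finsupp.sumElim_eq_add]
      exact hw.symm
    rw [hw, map_add, Finsupp.degree_mapDomain, Finsupp.degree_mapDomain] at hdeg
    have hmon : monomial v (coeff v p) =
        rename Sum.inl (monomial v₁ (coeff v p)) * rename Sum.inr (monomial v₂ (1 : k)) := by
      rw [rename_monomial, rename_monomial, monomial_mul, mul_one, ← hw]
    rw [hmon, hsm]
    refine AddSubgroup.subset_closure ⟨_, _, _, _, ?_,
      G.smul_mem (isHomogeneous_monomial _ rfl) hm,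
      H.smul_mem (isHomogeneous_monomial _ rfl) hn, rfl⟩
    rw [← hdeg]
    push_cast
    ring
  | zero => simp [zero_mem]
  | add x y _ _ hx hy => rw [smul_add]; exact add_mem hx hy
  | neg x _ hx => rw [smul_neg]; exact neg_mem hx

theorem mem_closure_tensGr (G : GradedDecomp k σ grM) (H : GradedDecomp k τ grN) (x : M ⊗[k] N) :
    x ∈ AddSubgroup.closure {x | ∃ t, x ∈ tensGr k M N grM grN t} := by
  induction x using TensorProduct.induction_on with
  | zero => exact zero_mem _
  | add x y hx hy => exact add_mem hx hy
  | tmul m n =>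
    induction G.span m using AddSubgroup.closure_induction with
    | mem m hm =>
      obtain ⟨a, hm⟩ := hm
      induction H.span n using AddSubgroup.closure_induction with
      | mem n hn =>
        obtain ⟨b, hn⟩ := hn
        exact AddSubgroup.subset_closure
          ⟨a + b, AddSubgroup.subset_closure ⟨a, b, m, n, rfl, hm, hn, rfl⟩⟩
      | zero => rw [tmul_zero]; exact zero_mem _
      | add x y _ _ hx hy => rw [tmul_add]; exact add_mem hx hy
      | neg x _ hx => rw [tmul_neg]; exact neg_mem hx
    | zero => rw [zero_tmul]; exact zero_mem _
    | add x y _ _ hx hy => rw [add_tmul]; exact add_mem hx hy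
    | neg x _ hx => rw [neg_tmul]; exact neg_mem hx

/-- The grading of the tensor product of two graded modules. -/
noncomputable def tensor [Module (MvPolynomial (σ ⊕ τ) k) (M ⊗[k] N)]
    (hsm : ∀ (a : MvPolynomial σ k) (b : MvPolynomial τ k) (m : M)
      (n : N), (rename Sum.inl a * rename Sum.inr b : MvPolynomial (σ ⊕ τ) k) • (m ⊗ₜ[k] n) =
        (a • m) ⊗ₜ (b • n))
    (G : GradedDecomp k σ grM) (H : GradedDecomp k τ grN) :
    GradedDecomp k (σ ⊕ τ) (tensGr k M N grM grN) where
  proj t := (Finsupp.lapply t ∘ₗ G.tensorComponents H).toAddMonoidHom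
  proj_same {t x} hx := by
    change G.tensorComponents H x t = x
    rw [tensorComponents_of_mem G H hx, Finsupp.single_eq_same]
  proj_ne {t t' x} hx h := by
    change G.tensorComponents H x t' = 0
    rw [tensorComponents_of_mem G H hx, Finsupp.single_eq_of_ne' h]
  smul_mem hp hx := smul_mem_tensGr hsm G H hp hx
  span := mem_closure_tensGr G H

end GradedDecomp

theorem toTensAlg_rename_mul_rename {r s : ℕ} (a : PA k r) (b : PB k s) :
    toTensAlg k r s (rename Sum.inl a * rename Sum.inr b) = a ⊗ₜ b := by
  have ha : toTensAlg k r s (rename Sum.inl a) =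
      (Algebra.TensorProduct.includeLeft : PA k r →ₐ[k] PA k r ⊗[k] PB k s) a := by
    rw [toTensAlg, aeval_rename]
    exact DFunLike.congr_fun (algHom_ext fun i => by simp :
      aeval _ = (Algebra.TensorProduct.includeLeft : PA k r →ₐ[k] PA k r ⊗[k] PB k s)) a
  have hb : toTensAlg k r s (rename Sum.inr b) = Algebra.TensorProduct.includeRight b := by
    rw [toTensAlg, aeval_rename]
    exact DFunLike.congr_fun (algHom_ext fun i => by simp :
      aeval _ = (Algebra.TensorProduct.includeRight : PB k s →ₐ[k] PA k r ⊗[k] PB k s)) b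
  rw [map_mul, ha, hb]
  simp

theorem compHom_smul_of_eq_tmul {A B R V : Type} [CommRing A] [CommRing B] [CommRing R]
    [Algebra k A] [Algebra k B] [Algebra k R] [AddCommMonoid V] [Module k V] [Module A V]
    [Module B V] [IsScalarTower k A V] [IsScalarTower k B V] [SMulCommClass A B V]
    (f : R →ₐ[k] A ⊗[k] B) {x : R} {a : A} {b : B} (h : f x = a ⊗ₜ b) (v : V) :
    letI : Module (A ⊗[k] B) V := TensorProduct.Algebra.module
    letI : Module R V := Module.compHom V f.toRingHom
    x • v = a • b • v := by
  let _ : Module (A ⊗[k] B) V := TensorProduct.Algebra.module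
  refine Eq.trans (?_ : _ = f x • v) ?_
  · rfl
  · rw [h, TensorProduct.Algebra.smul_def]

section

variable {r s : ℕ}
  (M : Type) [AddCommGroup M] [Module (PA k r) M] [Module k M] [IsScalarTower k (PA k r) M]
  (N : Type) [AddCommGroup N] [Module (PB k s) N] [Module k N] [IsScalarTower k (PB k s) N]

theorem rightModuleTens_isScalarTower :
    letI : Module (PB k s) (M ⊗[k] N) := rightModuleTens k M N
    IsScalarTower k (PB k s) (M ⊗[k] N) := by
  let _ : Module (PB k s) (M ⊗[k] N) := rightModuleTens k M N
  refine ⟨fun c b x => ?_⟩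
  change (TensorProduct.comm k M N).symm ((c • b) • TensorProduct.comm k M N x) =
    c • (TensorProduct.comm k M N).symm (b • TensorProduct.comm k M N x)
  rw [smul_assoc, map_smul]

theorem rightModuleTens_smulCommClass :
    letI : Module (PB k s) (M ⊗[k] N) := rightModuleTens k M N
    SMulCommClass (PA k r) (PB k s) (M ⊗[k] N) := by
  let _ : Module (PB k s) (M ⊗[k] N) := rightModuleTens k M N
  refine ⟨fun a b x => ?_⟩
  change a • (TensorProduct.comm k M N).symm (b • TensorProduct.comm k M N x) =
    (TensorProduct.comm k M N).symm (b • TensorProduct.comm k M N (a • x))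
  induction x using TensorProduct.induction_on with
  | zero => simp
  | tmul m n => simp [TensorProduct.smul_tmul']
  | add x y hx hy => simp only [map_add, smul_add, hx, hy]

theorem tensModuleR_smul_tmul (a : PA k r) (b : PB k s) (m : M) (n : N) :
    letI : Module (PR k r s) (M ⊗[k] N) := tensModuleR k M N
    (rename Sum.inl a * rename Sum.inr b : PR k r s) • (m ⊗ₜ[k] n) = (a • m) ⊗ₜ (b • n) :=
  letI : Module (PB k s) (M ⊗[k] N) := rightModuleTens k M N
  haveI := rightModuleTens_isScalarTower (k := k) (s := s) M N
  haveI := rightModuleTens_smulCommClass (k := k) (r := r) (s := s) M N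
  compHom_smul_of_eq_tmul (toTensAlg k r s) (toTensAlg_rename_mul_rename a b) (m ⊗ₜ[k] n)

end

end TensorGrading

section DepthRegularity

open TensorProduct

section

variable {k : Type} [Field k] {σ : Type} [Fintype σ] {M : Type} [AddCommGroup M]
  [Module (MvPolynomial σ k) M] {gr : ℤ → AddSubgroup M} {F : GradedFreeRes k σ M gr}

theorem GradedFreeRes.IsMinimal.exists_length [Nontrivial M] (hF : F.IsMinimal) :
    ∃ p ≤ Fintype.card σ, F.rk p ≠ 0 ∧ ∀ i, p < i → F.rk i = 0 := by
  classical
  refine ⟨Nat.findGreatest (fun i => F.rk i ≠ 0) (Fintype.card σ), Nat.findGreatest_le _,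
    Nat.findGreatest_spec (P := fun i => F.rk i ≠ 0) (Nat.zero_le _) F.rk_zero_ne_zero,
    fun i hi => ?_⟩
  by_contra h
  by_cases hi' : i ≤ Fintype.card σ
  · exact Nat.findGreatest_is_greatest hi hi' h
  · exact h (rk_eq_zero_of_minimal F.exact_succ hF (not_le.1 hi'))

theorem GradedFreeRes.IsMinimal.depthM_eq (hF : F.IsMinimal) {p e : ℕ} (hp : F.rk p ≠ 0)
    (hz : F.rk (p + 1) = 0) (he : e + p = Fintype.card σ) :
    depthM k (ModuleCat.of (MvPolynomial σ k) M) = e :=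
  (hF.hasExtDepth hp hz he).sInf_eq

end

theorem depth_reg_tensor_of_smul_tmul {k : Type} [Field k] {σ τ : Type} [Finite σ] [Finite τ]
    {M : Type} [AddCommGroup M] [Module (MvPolynomial σ k) M] [Module k M]
    [IsScalarTower k (MvPolynomial σ k) M] [Module.Finite (MvPolynomial σ k) M] [Nontrivial M]
    {N : Type} [AddCommGroup N] [Module (MvPolynomial τ k) N] [Module k N]
    [IsScalarTower k (MvPolynomial τ k) N] [Module.Finite (MvPolynomial τ k) N] [Nontrivial N]
    [Module (MvPolynomial (σ ⊕ τ) k) (M ⊗[k] N)]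
    (hsm : ∀ (a : MvPolynomial σ k) (b : MvPolynomial τ k) (m : M)
      (n : N), (rename Sum.inl a * rename Sum.inr b : MvPolynomial (σ ⊕ τ) k) • (m ⊗ₜ[k] n) =
        (a • m) ⊗ₜ (b • n))
    {grM : ℤ → AddSubgroup M} {grN : ℤ → AddSubgroup N}
    (G : GradedDecomp k σ grM) (H : GradedDecomp k τ grN) :
    depthM k (ModuleCat.of (MvPolynomial (σ ⊕ τ) k) (M ⊗[k] N)) =
        depthM k (ModuleCat.of (MvPolynomial σ k) M) +
          depthM k (ModuleCat.of (MvPolynomial τ k) N) ∧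
      regM k (σ ⊕ τ) (M ⊗[k] N) (tensGr k M N grM grN) = regM k σ M grM + regM k τ N grN := by
  have := Fintype.ofFinite σ
  have := Fintype.ofFinite τ
  obtain ⟨F, hF⟩ := G.exists_minimal_resolution
  obtain ⟨F', hF'⟩ := H.exists_minimal_resolution
  have := @Fintype.ofFinite _ F.finite_sigma
  have := @Fintype.ofFinite _ F'.finite_sigma
  let T := F.toTotalRes.tensor F'.toTotalRes hsm
  have hT : T.toGradedFreeRes.IsMinimal := T.toGradedFreeRes_isMinimal <|
    F.toTotalRes.constantCoeff_tensorD F'.toTotalRes hF.constantCoeff_totalD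
      hF'.constantCoeff_totalD
  constructor
  · obtain ⟨p, hpσ, hp, hp'⟩ := hF.exists_length
    obtain ⟨q, hqτ, hq, hq'⟩ := hF'.exists_length
    rw [hF.depthM_eq hp (hp' _ p.lt_succ_self) (Nat.sub_add_cancel hpσ),
      hF'.depthM_eq hq (hq' _ q.lt_succ_self) (Nat.sub_add_cancel hqτ)]
    refine hT.depthM_eq (p := p + q) ?_ ?_ ?_
    · refine (Fintype.card_pos_iff.2 ?_).ne'
      exact ⟨⟨(⟨p, ⟨0, Nat.pos_of_ne_zero hp⟩⟩, ⟨q, ⟨0, Nat.pos_of_ne_zero hq⟩⟩), rfl⟩⟩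
    · refine Fintype.card_eq_zero_iff.2 ⟨fun x => ?_⟩
      obtain ⟨⟨⟨a, x⟩, ⟨b, y⟩⟩, h⟩ := x
      have ha : a ≤ p := by
        by_contra ha
        exact x.pos.ne' (hp' a (not_le.1 ha))
      have hb : b ≤ q := by
        by_contra hb
        exact y.pos.ne' (hq' b (not_le.1 hb))
      change a + b = p + q + 1 at h
      omega
    · rw [Fintype.card_sum]
      omega
  · obtain ⟨i, l, hl⟩ := F.exists_max_tw
    obtain ⟨j, l', hl'⟩ := F'.exists_max_tw
    rw [hF.regM_eq G hl ⟨i, l, rfl⟩, hF'.regM_eq H hl' ⟨j, l', rfl⟩]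
    refine hT.regM_eq (G.tensor hsm H) (fun n x => ?_) ?_
    · obtain ⟨y, hy, hy'⟩ := T.exists_of_toGradedFreeRes x
      have h1 := hl y.1.1 y.1.2
      have h2 := hl' y.2.1 y.2.2
      rw [← hy']
      omega
    · obtain ⟨x, hx⟩ := T.exists_toGradedFreeRes_tw_eq (⟨i, l⟩, ⟨j, l'⟩)
      refine ⟨_, x, ?_⟩
      rw [hx]
      push_cast
      ring

end DepthRegularity

end PaperHTT

open PaperHTT in
open TensorProduct in
/-- Lemma 2.5 (Goto–Watanabe): for nonzero finitely generated graded modules `M` over `A`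
and `N` over `B`: (i) `depth (M ⊗_k N) = depth M + depth N`, and
(ii) `reg (M ⊗_k N) = reg M + reg N`. -/
theorem depth_reg_tensor
    (k : Type) [Field k] (r s : ℕ)
    (M : Type) [AddCommGroup M] [Module (PA k r) M] [Module k M]
    [IsScalarTower k (PA k r) M] [Module.Finite (PA k r) M] [Nontrivial M]
    (N : Type) [AddCommGroup N] [Module (PB k s) N] [Module k N]
    [IsScalarTower k (PB k s) N] [Module.Finite (PB k s) N] [Nontrivial N]
    (grM : ℤ → AddSubgroup M) (hgrM : IsGrading k (Fin r) grM)
    (grN : ℤ → AddSubgroup N) (hgrN : IsGrading k (Fin s) grN) :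
    letI : Module (PR k r s) (M ⊗[k] N) := tensModuleR k M N
    depthM k (ModuleCat.of (PR k r s) (M ⊗[k] N)) =
        depthM k (ModuleCat.of (PA k r) M) + depthM k (ModuleCat.of (PB k s) N) ∧
      regM k (Fin r ⊕ Fin s) (M ⊗[k] N) (tensGr k _ _ grM grN) =
        regM k (Fin r) M grM + regM k (Fin s) N grN := by
  let _ : Module (PR k r s) (M ⊗[k] N) := tensModuleR k M N
  exact depth_reg_tensor_of_smul_tmul (tensModuleR_smul_tmul M N) hgrM.gradedDecomp
    hgrN.gradedDecomp
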